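/- arXiv:1009.0484 — 2 statements merged into one kernel-verified Lean document; each statement's English description precedes it below -/
import Mathlib

section
/- Let $n \ge 1$, $1 \le p \le q < \infty$, $0 < \gamma < n$, and $\alpha, \beta \in \mathbb{R}$ satisfy $\alpha < \frac{n}{p'}$, $\beta < \frac{n}{q}$, $\alpha + \beta \ge (n-1)\left(\frac{1}{q} - \frac{1}{p}\right)$ (strict if $p = 1$), and $\frac{1}{q} = \frac{1}{p} + \frac{\gamma + \alpha + \beta}{n} - 1$. Then there exists $C > 0$ such that for all radially symmetric $v \in L^p(\mathbb{R}^n, |x|^{p\alpha} dx)$, $\left\| |x|^{-\beta} T_\gamma v \right\|_{L^q(\mathbb{R}^n)} \le C \left\| |x|^{\alpha} v \right\|_{L^p(\mathbb{R}^n)}$, where $(T_\gamma v)(x) = \int_{\mathbb{R}^n} \frac{v(y)}{|x-y|^{\gamma}} \, dy$. -/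
open MeasureTheory Set
open scoped Pointwise

abbrev SWE (n : ℕ) := EuclideanSpace ℝ (Fin n)

lemma sw_exp_subst (F : ℝ → ENNReal) :
    ∫⁻ s in Ioi (0:ℝ), F s = ∫⁻ t : ℝ, ENNReal.ofReal (Real.exp t) * F (Real.exp t) := by
  have h := lintegral_image_eq_lintegral_abs_deriv_mul (s := univ) (f := Real.exp)
    (f' := Real.exp) MeasurableSet.univ
    (fun x _ => (Real.hasDerivAt_exp x).hasDerivWithinAt) Real.exp_injective.injOn F
  rw [image_univ, Real.range_exp] at h
  rw [h]
  simp [abs_of_pos, Real.exp_pos]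

lemma sw_polar (n : ℕ) (hn : 1 ≤ n) (F : SWE n → ENNReal) (hF : Measurable F) :
    ∫⁻ y, F y = ∫⁻ t : ℝ, ENNReal.ofReal (Real.exp (n * t)) *
      ∫⁻ ω : Metric.sphere (0 : SWE n) 1,
        F (Real.exp t • (ω : SWE n))
        ∂(volume : Measure (SWE n)).toSphere := by
  have : Nonempty (Fin n) := ⟨⟨0, hn⟩⟩
  have hmp := (volume : Measure (SWE n)).measurePreserving_homeomorphUnitSphereProd
  let G : Metric.sphere (0 : (SWE n)) 1 × Ioi (0:ℝ) → ENNReal := fun z => F ((z.2 : ℝ) • (z.1 : (SWE n)))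
  have hG : Measurable G := by
    apply hF.comp
    fun_prop
  calc ∫⁻ y, F y = ∫⁻ x : ({(0)}ᶜ : Set (SWE n)), F x.1 ∂(Measure.comap Subtype.val volume) := by
        rw [lintegral_subtype_comap (measurableSet_singleton _).compl, restrict_compl_singleton]
    _ = ∫⁻ z, G z ∂(volume : Measure (SWE n)).toSphere.prod (.volumeIoiPow (Module.finrank ℝ (SWE n) - 1)) := by
        rw [← hmp.lintegral_comp hG]
        refine lintegral_congr fun x => ?_
        have hx : ‖(x : (SWE n))‖ ≠ 0 := norm_ne_zero_iff.mpr x.2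
        simp [G, smul_smul, hx]
    _ = ∫⁻ r : Ioi (0:ℝ), ∫⁻ ω, G (ω, r) ∂(volume : Measure (SWE n)).toSphere
          ∂(.volumeIoiPow (Module.finrank ℝ (SWE n) - 1)) := by
        rw [lintegral_prod_symm' _ hG]
    _ = ∫⁻ r in Ioi (0:ℝ), ENNReal.ofReal (r ^ (n-1)) *
          ∫⁻ ω : Metric.sphere (0 : (SWE n)) 1, F (r • (ω:(SWE n))) ∂(volume : Measure (SWE n)).toSphere := by
        have hm : Measurable fun r : Ioi (0:ℝ) => ∫⁻ ω, G (ω, r) ∂(volume : Measure (SWE n)).toSphere :=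
          hG.lintegral_prod_left'
        rw [Measure.volumeIoiPow, lintegral_withDensity_eq_lintegral_mul _ (by fun_prop) hm]
        have : Module.finrank ℝ (SWE n) = n := by simp
        rw [this]
        exact lintegral_subtype_comap measurableSet_Ioi (fun r : ℝ => ENNReal.ofReal (r ^ (n-1)) *
          ∫⁻ ω : Metric.sphere (0 : (SWE n)) 1, F (r • (ω:(SWE n))) ∂(volume : Measure (SWE n)).toSphere)
    _ = _ := by
        rw [sw_exp_subst]
        refine lintegral_congr fun t => ?_
        rw [← mul_assoc, ← ENNReal.ofReal_mul (Real.exp_pos _).le, ← pow_succ',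
          Nat.sub_add_cancel hn, ← Real.exp_nat_mul]

lemma sw_polar_rad (n : ℕ) (hn : 1 ≤ n) (F : ℝ → ENNReal) (hF : Measurable F) :
    ∫⁻ y : SWE n, F ‖y‖ =
      (volume : Measure (SWE n)).toSphere univ *
      ∫⁻ t : ℝ, ENNReal.ofReal (Real.exp (n * t)) * F (Real.exp t) := by
  rw [sw_polar n hn (fun y => F ‖y‖) (by fun_prop), ← lintegral_const_mul _ (by fun_prop)]
  refine lintegral_congr fun t => ?_
  simp [norm_smul]
  ring

lemma sw_cap (n : ℕ) (hn : 1 ≤ n) : ∃ C : ℝ, 0 < C ∧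
    ∀ e : SWE n, ‖e‖ = 1 → ∀ ρ : ℝ, 0 < ρ →
    (volume : Measure (SWE n)).toSphere
      {ω : Metric.sphere (0 : SWE n) 1 | ‖e - ω‖ < ρ}
      ≤ ENNReal.ofReal (C * ρ ^ (n - 1)) := by
  have : Nonempty (Fin n) := ⟨⟨0, hn⟩⟩
  set B : ℝ := (volume : Measure (SWE n)).real (Metric.ball 0 1) with hB
  have hB0 : 0 < B := by
    rw [hB, measureReal_def]
    exact ENNReal.toReal_pos (Metric.measure_ball_pos _ _ one_pos).ne' measure_ball_lt_top.ne
  have hBe : (volume : Measure (SWE n)) (Metric.ball 0 1) = ENNReal.ofReal B := by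
    rw [hB, measureReal_def, ENNReal.ofReal_toReal measure_ball_lt_top.ne]
  have hdim : Module.finrank ℝ (SWE n) = n := by simp
  have hn0 : (0:ℝ) < n := by exact_mod_cast hn
  refine ⟨n * (2 * (2:ℝ)^n * B), by positivity, fun e he ρ hρ => ?_⟩
  by_cases h1 : 1 ≤ ρ
  · calc _ ≤ (volume : Measure (SWE n)).toSphere univ := measure_mono (subset_univ _)
      _ = ENNReal.ofReal (n * B) := by
          rw [Measure.toSphere_apply_univ, hBe, hdim, ENNReal.ofReal_mul hn0.le,
            ENNReal.ofReal_natCast]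
      _ ≤ _ := by
          apply ENNReal.ofReal_le_ofReal
          have h2 : (1:ℝ) ≤ ρ ^ (n-1) := one_le_pow₀ h1
          have h3 : (1:ℝ) ≤ 2 ^ n := one_le_pow₀ (by norm_num)
          have h4 : (1:ℝ) ≤ 2 * (2:ℝ)^n * ρ^(n-1) := by nlinarith
          have : (n:ℝ) * B * 1 ≤ n * B * (2 * (2:ℝ)^n * ρ^(n-1)) := by gcongr
          linarith
  push Not at h1
  have hmeas : MeasurableSet {ω : Metric.sphere (0 : (SWE n)) 1 | ‖e - ω‖ < ρ} :=
    measurableSet_lt (by fun_prop) measurable_const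
  rw [Measure.toSphere_apply' _ hmeas, hdim]
  set N := ⌊1/ρ⌋₊ + 1 with hN
  have hsub : Ioo (0 : ℝ) 1 • ((fun ω : Metric.sphere (0 : (SWE n)) 1 => (ω:(SWE n))) ''
      {ω : Metric.sphere (0 : (SWE n)) 1 | ‖e - ω‖ < ρ}) ⊆
      ⋃ k ∈ Finset.range N, Metric.ball ((k * ρ) • e) (2*ρ) := by
    rintro y ⟨t, ⟨ht0, ht1⟩, _, ⟨ω, hω, rfl⟩, rfl⟩
    simp only [mem_ofPred_eq] at hω
    simp only [mem_iUnion, Finset.mem_range]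
    have hfl := Nat.floor_le (a := t/ρ) (by positivity)
    have hfl2 := Nat.lt_floor_add_one (t/ρ)
    rw [le_div_iff₀ hρ] at hfl
    rw [div_lt_iff₀ hρ] at hfl2
    refine ⟨⌊t/ρ⌋₊, ?_, ?_⟩
    · rw [hN, Nat.lt_succ_iff]
      apply Nat.floor_le_floor
      gcongr
    · rw [Metric.mem_ball, dist_eq_norm]
      have : t • (ω:(SWE n)) - ((⌊t/ρ⌋₊:ℝ) * ρ) • e = -(t • (e - ω)) + (t - ⌊t/ρ⌋₊ * ρ) • e := by
        module
      show ‖t • (ω:(SWE n)) - ((⌊t/ρ⌋₊:ℝ) * ρ) • e‖ < 2 * ρ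
      rw [this]
      calc _ ≤ ‖-(t • (e - (ω:(SWE n))))‖ + ‖(t - ⌊t/ρ⌋₊ * ρ) • e‖ := norm_add_le _ _
        _ = t * ‖e - (ω:(SWE n))‖ + (t - ⌊t/ρ⌋₊ * ρ) := by
            rw [norm_neg, norm_smul, norm_smul, he, Real.norm_of_nonneg ht0.le,
              Real.norm_of_nonneg (by linarith), mul_one]
        _ < 2 * ρ := by nlinarith [norm_nonneg (e - (ω:(SWE n)))]
  have hball : ∀ k : ℕ, (volume : Measure (SWE n)) (Metric.ball ((k * ρ) • e) (2*ρ)) =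
      ENNReal.ofReal ((2*ρ)^n * B) := fun k => by
    rw [Measure.addHaar_ball_of_pos _ _ (by positivity), hdim, hBe,
      ← ENNReal.ofReal_mul (by positivity)]
  calc _ ≤ (n : ENNReal) * ∑ k ∈ Finset.range N,
        (volume : Measure (SWE n)) (Metric.ball ((k * ρ) • e) (2*ρ)) := by
        gcongr
        exact (measure_mono hsub).trans (measure_biUnion_finset_le _ _)
    _ = ENNReal.ofReal (n * (N * ((2*ρ)^n * B))) := by
        simp only [hball, Finset.sum_const, Finset.card_range, nsmul_eq_mul]
        rw [ENNReal.ofReal_mul hn0.le, ENNReal.ofReal_mul (Nat.cast_nonneg N),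
          ENNReal.ofReal_natCast, ENNReal.ofReal_natCast]
    _ ≤ _ := by
        apply ENNReal.ofReal_le_ofReal
        have hNρ : N * ρ ≤ 2 := by
          have := Nat.floor_le (a := 1/ρ) (by positivity)
          rw [le_div_iff₀ hρ] at this
          rw [hN]; push_cast; nlinarith
        have hp : (2*ρ)^n = 2^n * (ρ^(n-1) * ρ) := by
          rw [mul_pow, ← pow_succ, Nat.sub_add_cancel hn]
        rw [hp]
        have : (N*ρ) * (n * 2^n * B * ρ^(n-1)) ≤ 2 * (n * 2^n * B * ρ^(n-1)) := by gcongr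
        nlinarith

lemma sw_tail (γ u : ℝ) (hγ : 0 < γ) (hu : 0 < u) :
    ∫⁻ ρ in Ioi u, ENNReal.ofReal (ρ ^ (-γ - 1)) = ENNReal.ofReal (u ^ (-γ) / γ) := by
  rw [← ofReal_integral_eq_lintegral_ofReal
    (integrableOn_Ioi_rpow_of_lt (by linarith) hu)]
  · rw [integral_Ioi_rpow_of_lt (by linarith) hu]
    congr 1
    rw [show -γ - 1 + 1 = -γ by ring, neg_div_neg_eq]
  · filter_upwards [ae_restrict_mem measurableSet_Ioi] with ρ hρ
    exact Real.rpow_nonneg (hu.trans hρ).le _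

/-- Spherical average of the Riesz kernel, supercritical exponent. -/
lemma sw_sphere_super (n : ℕ) (hn : 1 ≤ n) (ε : ℝ) (hε : 0 < ε) : ∃ C : ℝ, 0 < C ∧
    ∀ (x : SWE n) (s : ℝ), x ≠ 0 → 0 < s → ‖x‖ ≠ s →
    ∫⁻ ω : Metric.sphere (0 : SWE n) 1,
      ENNReal.ofReal (‖x - s • (ω : SWE n)‖ ^ (-(ε + (n - 1 : ℕ))))
        ∂(volume : Measure (SWE n)).toSphere
      ≤ ENNReal.ofReal (C * ((max ‖x‖ s) ^ (-((n - 1 : ℕ) : ℝ)) * |‖x‖ - s| ^ (-ε))) := by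
  obtain ⟨C, hC, hcap⟩ := sw_cap n hn
  set k : ℕ := n - 1
  set γ : ℝ := ε + k with hγdef
  have hγ : 0 < γ := by positivity
  refine ⟨γ * (C * 2 ^ k / ε), by positivity, fun x s hx hs hxs => ?_⟩
  set r := ‖x‖ with hr
  have hr0 : 0 < r := norm_pos_iff.mpr hx
  set M := max r s with hM
  have hM0 : 0 < M := lt_max_of_lt_left hr0
  set D := |r - s| with hD
  have hD0 : 0 < D := abs_pos.mpr (sub_ne_zero.mpr hxs)
  set σ := (volume : Measure (SWE n)).toSphere
  let u : Metric.sphere (0 : SWE n) 1 → ℝ := fun ω => ‖x - s • (ω : SWE n)‖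
  have hum : Measurable u := by fun_prop
  have hω1 : ∀ ω : Metric.sphere (0 : SWE n) 1, ‖(ω : SWE n)‖ = 1 := fun ω => by simp
  have huD : ∀ ω, D ≤ u ω := fun ω => by
    have := abs_norm_sub_norm_le x (s • (ω : SWE n))
    rwa [norm_smul, hω1, mul_one, Real.norm_of_nonneg hs.le] at this
  let e : SWE n := r⁻¹ • x
  have he : ‖e‖ = 1 := by
    simp only [e, norm_smul, norm_inv, ← hr, Real.norm_of_nonneg hr0.le]
    field_simp
  have hxe : x = r • e := by simp [e, smul_smul, hr0.ne']
  have hclose : ∀ ω : Metric.sphere (0 : SWE n) 1, M * ‖e - (ω : SWE n)‖ ≤ 2 * u ω := fun ω => by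
    have h1 := huD ω
    rcases le_total r s with h | h
    · rw [hM, max_eq_right h]
      have : s • (e - (ω : SWE n)) = (x - s • (ω : SWE n)) + (s - r) • e := by
        rw [hxe]; module
      calc s * ‖e - (ω : SWE n)‖ = ‖s • (e - (ω : SWE n))‖ := by
            rw [norm_smul, Real.norm_of_nonneg hs.le]
        _ ≤ u ω + ‖(s - r) • e‖ := by rw [this]; exact norm_add_le _ _
        _ = u ω + D := by
            rw [norm_smul, he, mul_one, Real.norm_eq_abs, hD, abs_sub_comm]
        _ ≤ _ := by linarith
    · rw [hM, max_eq_left h]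
      have : r • (e - (ω : SWE n)) = (x - s • (ω : SWE n)) + (s - r) • (ω : SWE n) := by
        rw [hxe]; module
      calc r * ‖e - (ω : SWE n)‖ = ‖r • (e - (ω : SWE n))‖ := by
            rw [norm_smul, Real.norm_of_nonneg hr0.le]
        _ ≤ u ω + ‖(s - r) • (ω : SWE n)‖ := by rw [this]; exact norm_add_le _ _
        _ = u ω + D := by
            rw [norm_smul, hω1, mul_one, Real.norm_eq_abs, hD, abs_sub_comm]
        _ ≤ _ := by linarith
  have hset : ∀ ρ, D < ρ → σ {ω | u ω < ρ} ≤ ENNReal.ofReal (C * (2 * ρ / M) ^ k) := by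
    intro ρ hρ
    refine (measure_mono ?_).trans (hcap e he (2 * ρ / M) (by have := hD0.trans hρ; positivity))
    intro ω hω
    simp only [mem_ofPred_eq] at hω ⊢
    rw [lt_div_iff₀ hM0]
    linarith [hclose ω]
  have hpt : ∀ ω, ENNReal.ofReal (u ω ^ (-γ)) = ENNReal.ofReal γ *
      ∫⁻ ρ in Ioi D, (if u ω < ρ then ENNReal.ofReal (ρ ^ (-γ - 1)) else 0) := fun ω => by
    have hu0 : 0 < u ω := hD0.trans_le (huD ω)
    have : ∫⁻ ρ in Ioi D, (if u ω < ρ then ENNReal.ofReal (ρ ^ (-γ - 1)) else 0) =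
        ∫⁻ ρ in Ioi (u ω), ENNReal.ofReal (ρ ^ (-γ - 1)) := by
      have h1 : (fun ρ : ℝ => if u ω < ρ then ENNReal.ofReal (ρ ^ (-γ - 1)) else 0) =
        (Ioi (u ω)).indicator (fun ρ => ENNReal.ofReal (ρ ^ (-γ - 1))) := by
        ext ρ; simp [indicator]
      rw [h1, setLIntegral_indicator measurableSet_Ioi,
        inter_eq_left.mpr (Ioi_subset_Ioi (huD ω))]
    rw [this, sw_tail γ _ hγ hu0, ← ENNReal.ofReal_mul hγ.le]
    congr 1
    field_simp
  calc ∫⁻ ω, ENNReal.ofReal (u ω ^ (-γ)) ∂σ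
      = ENNReal.ofReal γ * ∫⁻ ω, (∫⁻ ρ in Ioi D,
        (if u ω < ρ then ENNReal.ofReal (ρ ^ (-γ - 1)) else 0)) ∂σ := by
        simp_rw [hpt]
        rw [lintegral_const_mul']
        exact ENNReal.ofReal_ne_top
    _ = ENNReal.ofReal γ * ∫⁻ ρ in Ioi D, ∫⁻ ω,
        (if u ω < ρ then ENNReal.ofReal (ρ ^ (-γ - 1)) else 0) ∂σ := by
        rw [lintegral_lintegral_swap]
        refine (Measurable.ite (measurableSet_lt (hum.comp measurable_fst) measurable_snd)
          (by fun_prop) measurable_const).aemeasurable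
    _ ≤ ENNReal.ofReal γ * ∫⁻ ρ in Ioi D,
        ENNReal.ofReal (C * 2 ^ k * M ^ (-(k:ℝ))) * ENNReal.ofReal (ρ ^ (-ε - 1)) := by
        gcongr 1
        refine setLIntegral_mono' measurableSet_Ioi fun ρ hρ => ?_
        have hρ0 : 0 < ρ := hD0.trans hρ
        have h1 : (fun ω => if u ω < ρ then ENNReal.ofReal (ρ ^ (-γ - 1)) else 0) =
          {ω | u ω < ρ}.indicator (fun _ => ENNReal.ofReal (ρ ^ (-γ - 1))) := by
          ext ω; simp [indicator]
        rw [h1, lintegral_indicator_const (measurableSet_lt hum measurable_const)]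
        calc _ ≤ ENNReal.ofReal (ρ ^ (-γ - 1)) * ENNReal.ofReal (C * (2 * ρ / M) ^ k) := by
              gcongr; exact hset ρ hρ
          _ = _ := by
              rw [← ENNReal.ofReal_mul (by positivity), ← ENNReal.ofReal_mul (by positivity)]
              congr 1
              have h2 : ρ ^ (-ε - 1) = ρ ^ (-γ - 1) * ρ ^ k := by
                rw [← Real.rpow_natCast, ← Real.rpow_add hρ0]
                congr 1; rw [hγdef]; ring
              rw [h2, Real.rpow_neg hM0.le, Real.rpow_natCast, div_pow, mul_pow]
              field_simp
    _ = _ := by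
        rw [lintegral_const_mul' _ _ ENNReal.ofReal_ne_top, sw_tail ε D hε hD0,
          ← ENNReal.ofReal_mul (by positivity), ← ENNReal.ofReal_mul (by positivity)]
        congr 1
        ring

/-- Spherical average of the Riesz kernel in logarithmic coordinates. -/
lemma sw_sphere (n : ℕ) (hn : 1 ≤ n) (γ ε : ℝ) (hε : 0 < ε) (hγε : γ ≤ ε + ((n:ℝ) - 1)) :
    ∃ C : ℝ, 0 < C ∧
    ∀ (x : SWE n) (τ t : ℝ), ‖x‖ = Real.exp τ → τ ≠ t →
    ∫⁻ ω : Metric.sphere (0 : SWE n) 1,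
      ENNReal.ofReal (‖x - Real.exp t • (ω : SWE n)‖ ^ (-γ))
        ∂(volume : Measure (SWE n)).toSphere
      ≤ ENNReal.ofReal (C * (Real.exp (-γ * max τ t) * (1 - Real.exp (-|τ - t|)) ^ (-ε))) := by
  obtain ⟨C, hC, hsup⟩ := sw_sphere_super n hn ε hε
  have hk : ((n - 1 : ℕ) : ℝ) = n - 1 := by push_cast [hn]; ring
  set k : ℝ := ((n - 1 : ℕ) : ℝ) with hkdef
  have hk0 : 0 ≤ k := by positivity
  rw [← hk] at hγε
  refine ⟨2 ^ (ε + k - γ) * C, by positivity, fun x τ t hx hτt => ?_⟩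
  have hx0 : x ≠ 0 := by
    rw [← norm_pos_iff, hx]; exact Real.exp_pos _
  have hmax : max ‖x‖ (Real.exp t) = Real.exp (max τ t) := by
    rw [hx]; exact (Real.exp_monotone.map_max).symm
  have hne : ‖x‖ ≠ Real.exp t := by
    rw [hx]; exact fun h => hτt (Real.exp_injective h)
  have habs : |‖x‖ - Real.exp t| = Real.exp (max τ t) * (1 - Real.exp (-|τ - t|)) := by
    rw [hx]
    rcases le_total τ t with h | h
    · rw [max_eq_right h, abs_of_nonpos (by simpa using h), abs_of_nonpos (by linarith), mul_sub,
        ← Real.exp_add]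
      ring_nf
    · rw [max_eq_left h, abs_of_nonneg (by simpa using h), abs_of_nonneg (by linarith), mul_sub,
        ← Real.exp_add]
      ring_nf
  have h1 : 0 ≤ 1 - Real.exp (-|τ - t|) := by
    rw [sub_nonneg, Real.exp_le_one_iff]; simp
  have key := hsup x (Real.exp t) hx0 (Real.exp_pos t) hne
  rw [habs, hmax] at key
  have hpt : ∀ ω : Metric.sphere (0 : SWE n) 1,
      ENNReal.ofReal (‖x - Real.exp t • (ω : SWE n)‖ ^ (-γ)) ≤
      ENNReal.ofReal ((2 * Real.exp (max τ t)) ^ (ε + k - γ)) *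
      ENNReal.ofReal (‖x - Real.exp t • (ω : SWE n)‖ ^ (-(ε + k))) := fun ω => by
    rw [← ENNReal.ofReal_mul (by positivity)]
    apply ENNReal.ofReal_le_ofReal
    have hω1 : ‖(ω : SWE n)‖ = 1 := by simp
    have hu0 : 0 < ‖x - Real.exp t • (ω : SWE n)‖ := by
      rw [norm_pos_iff, sub_ne_zero]
      intro h
      apply hne
      rw [h, norm_smul, hω1, Real.norm_of_nonneg (Real.exp_pos _).le, mul_one]
    have hu1 : ‖x - Real.exp t • (ω : SWE n)‖ ≤ 2 * Real.exp (max τ t) := by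
      calc _ ≤ ‖x‖ + ‖Real.exp t • (ω : SWE n)‖ := norm_sub_le _ _
        _ = ‖x‖ + Real.exp t := by
            rw [norm_smul, hω1, Real.norm_of_nonneg (Real.exp_pos _).le, mul_one]
        _ ≤ _ := by
            rw [← hmax]; linarith [le_max_left ‖x‖ (Real.exp t), le_max_right ‖x‖ (Real.exp t)]
    calc _ = ‖x - Real.exp t • (ω : SWE n)‖ ^ (ε + k - γ) *
          ‖x - Real.exp t • (ω : SWE n)‖ ^ (-(ε + k)) := by
          rw [← Real.rpow_add hu0]; congr 1; ring
      _ ≤ _ := by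
          gcongr
  calc _ ≤ ∫⁻ ω : Metric.sphere (0 : SWE n) 1,
      ENNReal.ofReal ((2 * Real.exp (max τ t)) ^ (ε + k - γ)) *
      ENNReal.ofReal (‖x - Real.exp t • (ω : SWE n)‖ ^ (-(ε + k)))
        ∂(volume : Measure (SWE n)).toSphere := lintegral_mono hpt
    _ ≤ _ := by
        rw [lintegral_const_mul' _ _ ENNReal.ofReal_ne_top]
        grw [key]
        rw [← ENNReal.ofReal_mul (by positivity)]
        apply ENNReal.ofReal_le_ofReal
        apply le_of_eq
        rw [Real.mul_rpow (by norm_num) (Real.exp_pos _).le,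
          Real.mul_rpow (Real.exp_pos _).le h1, ← Real.exp_mul, ← Real.exp_mul, ← Real.exp_mul]
        have : Real.exp (-γ * max τ t) = Real.exp (max τ t * (ε + k - γ)) *
          Real.exp (max τ t * -k) * Real.exp (max τ t * -ε) := by
          rw [← Real.exp_add, ← Real.exp_add]; congr 1; ring
        rw [this]; ring
lemma sw_young (p q m : ℝ) (hp : 1 ≤ p) (hpq : p ≤ q) (hm : 1 / m = 1 - 1 / p + 1 / q)
    (κ g : ℝ → ENNReal) (hκ : Measurable κ) (hg : Measurable g) :
    ∫⁻ τ, (∫⁻ t, κ (τ - t) * g t) ^ q ≤ (∫⁻ u, κ u ^ m) ^ (q / m) * (∫⁻ t, g t ^ p) ^ (q / p) := by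
  have hp0 : 0 < p := by linarith
  have hq0 : 0 < q := by linarith
  have hpq' : 1 / q ≤ 1 / p := one_div_le_one_div_of_le hp0 hpq
  have hp1 : 1 / p ≤ 1 := by rw [div_le_one hp0]; exact hp
  have hq1 : 0 < 1 / q := by positivity
  have hm0 : 0 < m := by
    rw [← one_div_pos, hm]; linarith
  set A := ∫⁻ u, κ u ^ m with hA
  set G := ∫⁻ t, g t ^ p with hG
  have hpt : ∀ τ, (∫⁻ t, κ (τ - t) * g t) ≤
      (∫⁻ t, κ (τ - t) ^ m * g t ^ p) ^ (1 / q) * A ^ (1 - 1 / p) * G ^ (1 / p - 1 / q) := by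
    intro τ
    have h := ENNReal.lintegral_prod_norm_pow_le (μ := volume) (Finset.univ : Finset (Fin 3))
      (f := ![fun t => κ (τ - t) ^ m * g t ^ p, fun t => κ (τ - t) ^ m, fun t => g t ^ p])
      (p := ![1 / q, 1 - 1 / p, 1 / p - 1 / q])
      (by
        intro i _
        fin_cases i <;> simp <;> fun_prop)
      (by simp [Fin.sum_univ_three]; ring)
      (by
        intro i _
        fin_cases i
        · exact hq1.le
        · exact sub_nonneg.mpr hp1
        · exact sub_nonneg.mpr hpq')
    simp only [Fin.prod_univ_three] at h
    change ∫⁻ t, (κ (τ - t) ^ m * g t ^ p) ^ (1 / q) * (κ (τ - t) ^ m) ^ (1 - 1 / p) *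
        (g t ^ p) ^ (1 / p - 1 / q) ≤ (∫⁻ t, κ (τ - t) ^ m * g t ^ p) ^ (1 / q) *
        (∫⁻ t, κ (τ - t) ^ m) ^ (1 - 1 / p) * G ^ (1 / p - 1 / q) at h
    have h1 : ∫⁻ t, κ (τ - t) ^ m = A := lintegral_sub_left_eq_self (fun u => κ u ^ m) τ
    rw [h1] at h
    refine le_trans (le_of_eq (lintegral_congr fun t => ?_)) h
    rw [ENNReal.mul_rpow_of_nonneg _ _ hq1.le, ← ENNReal.rpow_mul, ← ENNReal.rpow_mul,
      ← ENNReal.rpow_mul, ← ENNReal.rpow_mul]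
    have e1 : κ (τ - t) = κ (τ - t) ^ (m * (1/q)) * κ (τ - t) ^ (m * (1 - 1/p)) := by
      rw [← ENNReal.rpow_add_of_nonneg _ _ (by positivity)
        (mul_nonneg hm0.le (by linarith)), ← mul_add,
        show 1/q + (1 - 1/p) = 1/m by rw [hm]; ring, mul_one_div_cancel hm0.ne', ENNReal.rpow_one]
    have e2 : g t = g t ^ (p * (1/q)) * g t ^ (p * (1/p - 1/q)) := by
      rw [← ENNReal.rpow_add_of_nonneg _ _ (by positivity)
        (mul_nonneg hp0.le (by linarith)), ← mul_add,
        show 1/q + (1/p - 1/q) = 1/p by ring, mul_one_div_cancel hp0.ne', ENNReal.rpow_one]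
    conv_lhs => rw [e1, e2]
    ring
  calc _ ≤ ∫⁻ τ, (∫⁻ t, κ (τ - t) ^ m * g t ^ p) *
        (A ^ (q * (1 - 1 / p)) * G ^ (q * (1 / p - 1 / q))) := by
        refine lintegral_mono fun τ => ?_
        refine (ENNReal.rpow_le_rpow (hpt τ) hq0.le).trans (le_of_eq ?_)
        rw [ENNReal.mul_rpow_of_nonneg _ _ hq0.le, ENNReal.mul_rpow_of_nonneg _ _ hq0.le,
          ← ENNReal.rpow_mul, ← ENNReal.rpow_mul, ← ENNReal.rpow_mul,
          one_div_mul_cancel hq0.ne', ENNReal.rpow_one, mul_assoc]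
        congr 3 <;> ring
    _ = (∫⁻ t, ∫⁻ τ, κ (τ - t) ^ m * g t ^ p) *
        (A ^ (q * (1 - 1 / p)) * G ^ (q * (1 / p - 1 / q))) := by
        rw [lintegral_mul_const _ (by
          exact Measurable.lintegral_prod_right'
            (f := fun z : ℝ × ℝ => κ (z.1 - z.2) ^ m * g z.2 ^ p) (by fun_prop)), lintegral_lintegral_swap]
        fun_prop
    _ = (A * G) * (A ^ (q * (1 - 1 / p)) * G ^ (q * (1 / p - 1 / q))) := by
        congr 1
        rw [hG, ← lintegral_const_mul _ (by fun_prop)]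
        refine lintegral_congr fun t => ?_
        rw [lintegral_mul_const _ (by fun_prop)]
        congr 1
        exact lintegral_sub_right_eq_self (fun u => κ u ^ m) t
    _ = _ := by
        have e1 : A ^ (q / m) = A * A ^ (q * (1 - 1/p)) := by
          conv_rhs => rw [← ENNReal.rpow_one A, ← ENNReal.rpow_mul, one_mul]
          rw [← ENNReal.rpow_add_of_nonneg _ _ zero_le_one (mul_nonneg hq0.le (by linarith))]
          congr 1
          rw [div_eq_mul_one_div, hm]; field_simp; ring
        have e2 : G ^ (q / p) = G * G ^ (q * (1/p - 1/q)) := by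
          conv_rhs => rw [← ENNReal.rpow_one G, ← ENNReal.rpow_mul, one_mul]
          rw [← ENNReal.rpow_add_of_nonneg _ _ zero_le_one (mul_nonneg hq0.le (by linarith))]
          congr 1
          field_simp; ring
        rw [e1, e2]; ring

lemma sw_even (F : ℝ → ENNReal) :
    ∫⁻ u : ℝ, F |u| = 2 * ∫⁻ s in Ioi (0:ℝ), F s := by
  have h1 : ∫⁻ u in Ioi (0:ℝ), F |u| = ∫⁻ s in Ioi (0:ℝ), F s :=
    setLIntegral_congr_fun measurableSet_Ioi fun u hu => by simp only [abs_of_pos hu.out]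
  have h2 : ∫⁻ u in Iio (0:ℝ), F |u| = ∫⁻ s in Ioi (0:ℝ), F s := by
    have := lintegral_image_eq_lintegral_abs_deriv_mul (s := Iio (0:ℝ)) (f := fun x => -x)
      (f' := fun _ => -1) measurableSet_Iio (fun x _ => (hasDerivAt_neg x).hasDerivWithinAt)
      neg_injective.injOn F
    simp at this
    rw [this]
    exact setLIntegral_congr_fun measurableSet_Iio fun u hu => by simp only [abs_of_neg hu.out]
  rw [← lintegral_add_compl (fun u : ℝ => F |u|) (measurableSet_Ioi (a := (0:ℝ))), h1,
    compl_Ioi, ← setLIntegral_congr (Iio_ae_eq_Iic (a := (0:ℝ))), h2, two_mul]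

lemma sw_near (θ R : ℝ) (hθ : θ < 1) (hR : 0 < R) :
    ∫⁻ s in Ioc 0 R, ENNReal.ofReal (s ^ (-θ)) = ENNReal.ofReal (R ^ (1 - θ) / (1 - θ)) := by
  have hi : IntegrableOn (fun s : ℝ => s ^ (-θ)) (Ioc 0 R) :=
    (intervalIntegrable_iff_integrableOn_Ioc_of_le hR.le).mp
      (intervalIntegral.intervalIntegrable_rpow' (by linarith))
  rw [← ofReal_integral_eq_lintegral_ofReal hi]
  · rw [← intervalIntegral.integral_of_le hR.le, integral_rpow (Or.inl (by linarith))]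
    rw [Real.zero_rpow (by linarith), sub_zero, neg_add_eq_sub]
  · filter_upwards [ae_restrict_mem measurableSet_Ioc] with ρ hρ
    exact Real.rpow_nonneg hρ.1.le _

/-- truncated bound for the fractional integral on the line -/
lemma sw_half (P θ : ℝ) (hP : 1 < P) (hθ1 : θ < 1) (hθP : 1 - 1 / P < θ) :
    ∃ C : ℝ, 0 < C ∧ ∀ f : ℝ → ENNReal, Measurable f → ∫⁻ t, f t ^ P ≤ 1 →
      ∀ (lam : ℝ) (τ : ℝ), 0 < lam →
      ∫⁻ t, ENNReal.ofReal (|τ - t| ^ (-θ)) * {t | f t ≤ ENNReal.ofReal lam}.indicator f t ≤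
        ENNReal.ofReal (C * lam ^ (1 - P * (1 - θ))) := by
  have hP0 : 0 < P := by linarith
  set P' := P / (P - 1) with hP'
  have hP'0 : 0 < P' := div_pos hP0 (by linarith)
  have hconj : P'.HolderConjugate P := by
    have : P.HolderConjugate P' := Real.HolderConjugate.conjExponent hP
    exact this.symm
  have hinv : 1 / P' = 1 - 1 / P := by
    rw [hP']; field_simp
  have hη : 0 < θ * P' - 1 := by
    have h : (1 / P') * P' < θ * P' := by
      gcongr; rw [hinv]; exact hθP
    rw [one_div_mul_cancel hP'0.ne'] at h
    linarith
  have hθ0 : 0 < θ := by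
    have : 1 / P < 1 := by rw [div_lt_one hP0]; exact hP
    linarith
  have h1θ : 0 < 1 - θ := by linarith
  refine ⟨2 / (1 - θ) + (2 / (θ * P' - 1)) ^ (1 / P'), by positivity,
    fun f hf hfP lam τ hlam => ?_⟩
  set R := lam ^ (-P) with hR
  have hR0 : 0 < R := by positivity
  -- near part
  let κ₁ : ℝ → ENNReal := fun u => (Ioc 0 R).indicator (fun s => ENNReal.ofReal (s ^ (-θ))) |u|
  let κ₂ : ℝ → ENNReal := fun u => (Ioi R).indicator (fun s => ENNReal.ofReal (s ^ (-θ))) |u|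
  have hm1 : Measurable κ₁ :=
    (Measurable.indicator (by fun_prop) measurableSet_Ioc).comp measurable_abs
  have hm2 : Measurable κ₂ :=
    (Measurable.indicator (by fun_prop) measurableSet_Ioi).comp measurable_abs
  have hsplit : ∀ u : ℝ, ENNReal.ofReal (|u| ^ (-θ)) ≤ κ₁ u + κ₂ u := fun u => by
    by_cases h0 : |u| = 0
    · rw [h0, Real.zero_rpow (by linarith)]; simp
    have h0' : 0 < |u| := lt_of_le_of_ne (abs_nonneg u) (Ne.symm h0)
    by_cases h : |u| ≤ R
    · have : |u| ∈ Ioc 0 R := ⟨h0', h⟩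
      simp only [κ₁, indicator_of_mem this]
      exact le_self_add
    · have : |u| ∈ Ioi R := not_le.mp h
      simp only [κ₂, indicator_of_mem this]
      exact le_add_self
  have hI1 : ∫⁻ u, κ₁ u = ENNReal.ofReal (2 * (R ^ (1 - θ) / (1 - θ))) := by
    rw [sw_even ((Ioc 0 R).indicator (fun s => ENNReal.ofReal (s ^ (-θ)))),
      setLIntegral_indicator measurableSet_Ioc,
      inter_eq_left.mpr Ioc_subset_Ioi_self, sw_near θ R hθ1 hR0,
      ENNReal.ofReal_mul (by norm_num)]
    simp
  have hI2 : ∫⁻ u, κ₂ u ^ P' = ENNReal.ofReal (2 * (R ^ (-(θ * P' - 1)) / (θ * P' - 1))) := by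
    have : ∀ u, κ₂ u ^ P' = (Ioi R).indicator
        (fun s => ENNReal.ofReal (s ^ (-(θ * P' - 1) - 1))) |u| := fun u => by
      by_cases h : |u| ∈ Ioi R
      · simp only [κ₂, indicator_of_mem h]
        rw [ENNReal.ofReal_rpow_of_nonneg (by positivity) hP'0.le, ← Real.rpow_mul (abs_nonneg _)]
        congr 2; ring
      · simp only [κ₂, indicator_of_notMem h]
        exact ENNReal.zero_rpow_of_pos hP'0
    simp_rw [this]
    rw [sw_even ((Ioi R).indicator (fun s => ENNReal.ofReal (s ^ (-(θ * P' - 1) - 1)))),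
      setLIntegral_indicator measurableSet_Ioi,
      inter_eq_left.mpr (Ioi_subset_Ioi hR0.le), sw_tail _ R hη hR0,
      ENNReal.ofReal_mul (by norm_num)]
    simp
  have hfm : ∀ t, {t | f t ≤ ENNReal.ofReal lam}.indicator f t ≤ ENNReal.ofReal lam := fun t => by
    by_cases h : t ∈ {t | f t ≤ ENNReal.ofReal lam}
    · rw [indicator_of_mem h]; exact h
    · rw [indicator_of_notMem h]; exact bot_le
  calc _ ≤ ∫⁻ t, (κ₁ (τ - t) * ENNReal.ofReal lam + κ₂ (τ - t) * f t) := by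
        refine lintegral_mono fun t => ?_
        refine (mul_le_mul_left (hsplit (τ - t)) _).trans ?_
        rw [add_mul]
        gcongr
        · exact hfm t
        · exact indicator_le_self _ _ _
    _ = (∫⁻ u, κ₁ u) * ENNReal.ofReal lam + ∫⁻ t, κ₂ (τ - t) * f t := by
        rw [lintegral_add_left (by fun_prop), lintegral_mul_const _ (by fun_prop),
          lintegral_sub_left_eq_self κ₁ τ]
    _ ≤ (∫⁻ u, κ₁ u) * ENNReal.ofReal lam + (∫⁻ u, κ₂ u ^ P') ^ (1 / P') * 1 := by
        gcongr
        refine (ENNReal.lintegral_mul_le_Lp_mul_Lq volume hconj (by fun_prop) hf.aemeasurable).trans ?_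
        rw [lintegral_sub_left_eq_self (fun u => κ₂ u ^ P') τ]
        gcongr
        exact ENNReal.rpow_le_one hfP (by positivity)
    _ = _ := by
        rw [hI1, hI2, mul_one, ENNReal.ofReal_rpow_of_nonneg (by positivity) (by positivity),
          ← ENNReal.ofReal_mul (by positivity), ← ENNReal.ofReal_add (by positivity) (by positivity)]
        congr 1
        have e1 : R ^ (1 - θ) * lam = lam ^ (1 - P * (1 - θ)) := by
          rw [hR, ← Real.rpow_mul hlam.le]
          conv_lhs => rw [← Real.rpow_one lam, ← Real.rpow_mul hlam.le, one_mul]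
          rw [← Real.rpow_add hlam]; congr 1; ring
        have e2 : (R ^ (-(θ * P' - 1))) ^ (1 / P') = lam ^ (1 - P * (1 - θ)) := by
          rw [hR, ← Real.rpow_mul hlam.le, ← Real.rpow_mul hlam.le]
          congr 1
          have : -P * -(θ * P' - 1) * (1 / P') = P * (θ - 1 / P') := by field_simp
          rw [this, hinv]; field_simp; ring
        rw [show 2 * (R ^ (-(θ * P' - 1)) / (θ * P' - 1)) =
            R ^ (-(θ * P' - 1)) * (2 / (θ * P' - 1)) by ring,
          Real.mul_rpow (x := R ^ (-(θ * P' - 1))) (by positivity) (by positivity), e2, add_mul, ← e1]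
        ring

lemma sw_half_bil (P Q θ : ℝ) (hP : 1 < P) (hQ : 1 < Q) (hθ1 : θ < 1)
    (hθ : θ = 2 - 1 / P - 1 / Q) :
    ∃ C : ℝ, 0 < C ∧ ∀ f h : ℝ → ENNReal, Measurable f → Measurable h →
      ∫⁻ t, f t ^ P ≤ 1 → ∫⁻ t, h t ^ Q ≤ 1 →
      ∫⁻ τ, h τ * ∫⁻ t, ENNReal.ofReal (|τ - t| ^ (-θ)) *
        {t | f t ^ P ≤ h τ ^ Q}.indicator f t ≤ ENNReal.ofReal C := by
  have hP0 : 0 < P := by linarith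
  have hQ0 : 0 < Q := by linarith
  have hQ1 : 1 / Q < 1 := by rw [div_lt_one hQ0]; exact hQ
  obtain ⟨C, hC, hhalf⟩ := sw_half P θ hP hθ1 (by linarith)
  refine ⟨C, hC, fun f h hf hh hfP hhQ => ?_⟩
  have hfin : ∀ᵐ τ, h τ ^ Q < ⊤ :=
    ae_lt_top (by fun_prop) (ne_top_of_le_ne_top ENNReal.one_ne_top hhQ)
  calc _ ≤ ∫⁻ τ, ENNReal.ofReal C * h τ ^ Q := by
        refine lintegral_mono_ae ?_
        filter_upwards [hfin] with τ hτ
        by_cases h0 : h τ = 0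
        · rw [h0]; simp
        have htop : h τ ≠ ⊤ := fun ht => by
          rw [ht, ENNReal.top_rpow_of_pos hQ0] at hτ; exact lt_irrefl _ hτ
        set a := (h τ).toReal with ha
        have ha0 : 0 < a := ENNReal.toReal_pos h0 htop
        have hha : h τ = ENNReal.ofReal a := (ENNReal.ofReal_toReal htop).symm
        have hset : {t | f t ^ P ≤ h τ ^ Q} = {t | f t ≤ ENNReal.ofReal (a ^ (Q / P))} := by
          ext t
          simp only [mem_ofPred_eq]
          rw [← ENNReal.ofReal_rpow_of_pos ha0, ← hha, div_eq_mul_inv, ENNReal.rpow_mul,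
            ENNReal.le_rpow_inv_iff hP0]
        rw [hset]
        refine (mul_le_mul_right (hhalf f hf hfP (a ^ (Q / P)) τ (by positivity)) _).trans
          (le_of_eq ?_)
        rw [hha, ENNReal.ofReal_rpow_of_pos ha0, ← ENNReal.ofReal_mul ha0.le,
          ← ENNReal.ofReal_mul hC.le]
        congr 1
        rw [← Real.rpow_mul ha0.le]
        have : a ^ Q = a * a ^ (Q / P * (1 - P * (1 - θ))) := by
          conv_rhs => rw [← Real.rpow_one a, ← Real.rpow_mul ha0.le, one_mul]
          rw [← Real.rpow_add ha0]; congr 1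
          rw [hθ]; field_simp; ring
        rw [this]; ring
    _ = ENNReal.ofReal C * ∫⁻ τ, h τ ^ Q := lintegral_const_mul _ (by fun_prop)
    _ ≤ ENNReal.ofReal C * 1 := by gcongr
    _ = _ := mul_one _

lemma sw_bil (P Q θ : ℝ) (hP : 1 < P) (hQ : 1 < Q) (hθ1 : θ < 1)
    (hθ : θ = 2 - 1 / P - 1 / Q) :
    ∃ C : ℝ, 0 < C ∧ ∀ f h : ℝ → ENNReal, Measurable f → Measurable h →
      ∫⁻ t, f t ^ P ≤ 1 → ∫⁻ t, h t ^ Q ≤ 1 →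
      ∫⁻ τ, h τ * ∫⁻ t, ENNReal.ofReal (|τ - t| ^ (-θ)) * f t ≤ ENNReal.ofReal C := by
  obtain ⟨C₁, hC₁, H₁⟩ := sw_half_bil P Q θ hP hQ hθ1 hθ
  obtain ⟨C₂, hC₂, H₂⟩ := sw_half_bil Q P θ hQ hP hθ1 (by rw [hθ]; ring)
  refine ⟨C₁ + C₂, by positivity, fun f h hf hh hfP hhQ => ?_⟩
  have hS1 : MeasurableSet {z : ℝ × ℝ | f z.2 ^ P ≤ h z.1 ^ Q} :=
    measurableSet_le (by fun_prop) (by fun_prop)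
  have hS2 : MeasurableSet {z : ℝ × ℝ | h z.1 ^ Q ≤ f z.2 ^ P} :=
    measurableSet_le (by fun_prop) (by fun_prop)
  let F₁ : ℝ × ℝ → ENNReal := {z : ℝ × ℝ | f z.2 ^ P ≤ h z.1 ^ Q}.indicator
    (fun z => h z.1 * (ENNReal.ofReal (|z.1 - z.2| ^ (-θ)) * f z.2))
  let F₂ : ℝ × ℝ → ENNReal := {z : ℝ × ℝ | h z.1 ^ Q ≤ f z.2 ^ P}.indicator
    (fun z => h z.1 * (ENNReal.ofReal (|z.1 - z.2| ^ (-θ)) * f z.2))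
  have hF₁ : Measurable F₁ := Measurable.indicator (by fun_prop) hS1
  have hF₂ : Measurable F₂ := Measurable.indicator (by fun_prop) hS2
  calc _ = ∫⁻ τ, ∫⁻ t, h τ * (ENNReal.ofReal (|τ - t| ^ (-θ)) * f t) := by
        refine lintegral_congr fun τ => ?_
        rw [lintegral_const_mul _ (by fun_prop)]
    _ ≤ ∫⁻ τ, ∫⁻ t, (F₁ (τ, t) + F₂ (τ, t)) := by
        refine lintegral_mono fun τ => lintegral_mono fun t => ?_
        rcases le_total (f t ^ P) (h τ ^ Q) with hle | hle
        · have : (τ, t) ∈ {z : ℝ × ℝ | f z.2 ^ P ≤ h z.1 ^ Q} := hle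
          simp only [F₁, indicator_of_mem this]
          exact le_self_add
        · have : (τ, t) ∈ {z : ℝ × ℝ | h z.1 ^ Q ≤ f z.2 ^ P} := hle
          simp only [F₂, indicator_of_mem this]
          exact le_add_self
    _ = (∫⁻ τ, ∫⁻ t, F₁ (τ, t)) + ∫⁻ t, ∫⁻ τ, F₂ (τ, t) := by
        rw [lintegral_lintegral_swap (f := fun t τ => F₂ (τ, t))
          (hF₂.comp measurable_swap).aemeasurable]
        rw [← lintegral_add_left hF₁.lintegral_prod_right']
        refine lintegral_congr fun τ => ?_
        rw [lintegral_add_left (by fun_prop)]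
    _ ≤ ENNReal.ofReal C₁ + ENNReal.ofReal C₂ := by
        gcongr
        · refine le_trans (le_of_eq ?_) (H₁ f h hf hh hfP hhQ)
          refine lintegral_congr fun τ => ?_
          rw [← lintegral_const_mul]
          · refine lintegral_congr fun t => ?_
            simp only [F₁, indicator, mem_ofPred_eq]
            split_ifs <;> simp
          · exact Measurable.mul (by fun_prop) (hf.indicator (measurableSet_le (by fun_prop) (by fun_prop)))
        · refine le_trans (le_of_eq ?_) (H₂ h f hh hf hhQ hfP)
          refine lintegral_congr fun τ => ?_
          rw [← lintegral_const_mul]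
          · refine lintegral_congr fun t => ?_
            simp only [F₂, indicator, mem_ofPred_eq]
            rw [abs_sub_comm]
            split_ifs
            · ring
            · simp
          · exact Measurable.mul (by fun_prop) (hh.indicator (measurableSet_le (by fun_prop) (by fun_prop)))
    _ = _ := (ENNReal.ofReal_add hC₁.le hC₂.le).symm

lemma sw_hls (p q θ : ℝ) (hp : 1 < p) (hpq : p < q) (hθ : θ = 1 - 1 / p + 1 / q) :
    ∃ C : ℝ, 0 < C ∧ ∀ g : ℝ → ENNReal, Measurable g →
      ∫⁻ τ, (∫⁻ t, ENNReal.ofReal (|τ - t| ^ (-θ)) * g t) ^ q ≤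
        ENNReal.ofReal C * (∫⁻ t, g t ^ p) ^ (q / p) := by
  have hp0 : 0 < p := by linarith
  have hq1 : 1 < q := by linarith
  have hq0 : 0 < q := by linarith
  set Q := q / (q - 1) with hQdef
  have hQ : 1 < Q := by rw [hQdef, lt_div_iff₀ (by linarith)]; linarith
  have hQ0 : 0 < Q := by linarith
  have hpq' : 1 / q < 1 / p := one_div_lt_one_div_of_lt hp0 hpq
  obtain ⟨C, hC, H⟩ := sw_bil p Q θ hp hQ (by linarith) (by
    have hq1' : q - 1 ≠ 0 := by linarith
    rw [hθ, hQdef]; field_simp; ring)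
  refine ⟨C ^ q, by positivity, fun g hg => ?_⟩
  -- normalized version
  have norm : ∀ f : ℝ → ENNReal, Measurable f → ∫⁻ t, f t ^ p ≤ 1 →
      ∫⁻ τ, (∫⁻ t, ENNReal.ofReal (|τ - t| ^ (-θ)) * f t) ^ q ≤ ENNReal.ofReal (C ^ q) := by
    intro f hf hfp
    set F : ℝ → ENNReal := fun τ => ∫⁻ t, ENNReal.ofReal (|τ - t| ^ (-θ)) * f t with hFdef
    have hF : Measurable F :=
      Measurable.lintegral_prod_right'
        (f := fun z : ℝ × ℝ => ENNReal.ofReal (|z.1 - z.2| ^ (-θ)) * f z.2) (by fun_prop)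
    let FN : ℕ → ℝ → ENNReal := fun N =>
      (Icc (-(N:ℝ)) N).indicator (fun τ => min (F τ) (N : ENNReal))
    have hFN : ∀ N, Measurable (FN N) := fun N =>
      (hF.min measurable_const).indicator measurableSet_Icc
    have hFNle : ∀ N τ, FN N τ ≤ F τ := fun N τ =>
      (indicator_le_self _ _ τ).trans (min_le_left _ _)
    have hbd : ∀ N, ∫⁻ τ, FN N τ ^ q ≤ ENNReal.ofReal (C ^ q) := by
      intro N
      set B := ∫⁻ τ, FN N τ ^ q with hB
      have hBtop : B ≠ ⊤ := by
        refine ne_top_of_le_ne_top ?_ (lintegral_mono (g := (Icc (-(N:ℝ)) N).indicator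
          (fun _ => (N : ENNReal) ^ q)) fun τ => ?_)
        · rw [lintegral_indicator_const measurableSet_Icc]
          refine ENNReal.mul_ne_top (ENNReal.rpow_ne_top_of_nonneg hq0.le (by simp)) (by simp)
        · by_cases hτ : τ ∈ Icc (-(N:ℝ)) N
          · simp only [FN, indicator_of_mem hτ]
            exact ENNReal.rpow_le_rpow (min_le_right _ _) hq0.le
          · simp only [FN, indicator_of_notMem hτ]
            rw [ENNReal.zero_rpow_of_pos hq0]
      by_cases hB0 : B = 0
      · rw [hB0]; exact bot_le
      let c : ENNReal := B ^ (-(1 / Q))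
      have hc0 : c ≠ 0 := by simp [c, ENNReal.rpow_eq_zero_iff, hB0, hBtop]
      have hctop : c ≠ ⊤ := by simp [c, ENNReal.rpow_eq_top_iff, hB0, hBtop]
      let h : ℝ → ENNReal := fun τ => c * FN N τ ^ (q - 1)
      have hh : Measurable h := ((hFN N).pow_const _).const_mul _
      have hhQ : ∫⁻ τ, h τ ^ Q ≤ 1 := by
        have e : ∀ τ, h τ ^ Q = B⁻¹ * FN N τ ^ q := fun τ => by
          simp only [h, c]
          rw [ENNReal.mul_rpow_of_nonneg _ _ hQ0.le, ← ENNReal.rpow_mul, ← ENNReal.rpow_mul,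
            neg_mul, one_div_mul_cancel hQ0.ne', ENNReal.rpow_neg_one]
          congr 2
          rw [hQdef]; field_simp [show q - 1 ≠ 0 by linarith]
        simp_rw [e]
        rw [lintegral_const_mul' _ _ (ENNReal.inv_ne_top.mpr hB0), ← hB,
          ENNReal.inv_mul_cancel hB0 hBtop]
      have key := H f h hf hh hfp hhQ
      have low : B ^ (1 / q) ≤ ENNReal.ofReal C := by
        refine le_trans ?_ key
        calc B ^ (1 / q) = c * B := by
              have : 1 / q = -(1 / Q) + 1 := by
                rw [hQdef]; field_simp; ring
              rw [this, ENNReal.rpow_add _ _ hB0 hBtop, ENNReal.rpow_one]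
          _ = ∫⁻ τ, c * FN N τ ^ q := by rw [lintegral_const_mul' _ _ hctop]
          _ ≤ ∫⁻ τ, h τ * F τ := by
              refine lintegral_mono fun τ => ?_
              simp only [h]
              rw [mul_assoc]
              gcongr
              calc FN N τ ^ q = FN N τ ^ (q - 1) * FN N τ := by
                    conv_rhs => rw [← ENNReal.rpow_one (FN N τ), ← ENNReal.rpow_mul, one_mul]
                    rw [← ENNReal.rpow_add_of_nonneg _ _ (by linarith) zero_le_one,
                      sub_add_cancel]
                _ ≤ _ := by gcongr; exact hFNle N τ
      calc B = (B ^ (1 / q)) ^ q := by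
            rw [← ENNReal.rpow_mul, one_div_mul_cancel hq0.ne', ENNReal.rpow_one]
        _ ≤ (ENNReal.ofReal C) ^ q := ENNReal.rpow_le_rpow low hq0.le
        _ = _ := ENNReal.ofReal_rpow_of_pos hC
    have hlim : Filter.Tendsto (fun N => ∫⁻ τ, FN N τ ^ q) Filter.atTop
        (nhds (∫⁻ τ, F τ ^ q)) := by
      refine lintegral_tendsto_of_tendsto_of_monotone
        (fun N => ((hFN N).pow_const _).aemeasurable) (Filter.Eventually.of_forall fun τ => ?_)
        (Filter.Eventually.of_forall fun τ => ?_)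
      · intro N M hNM
        have hNM' : (N:ℝ) ≤ M := by exact_mod_cast hNM
        refine ENNReal.rpow_le_rpow ?_ hq0.le
        simp only [FN]
        by_cases hτ : τ ∈ Icc (-(N:ℝ)) N
        · have hτ' : τ ∈ Icc (-(M:ℝ)) M := ⟨by linarith [hτ.1], by linarith [hτ.2]⟩
          rw [indicator_of_mem hτ, indicator_of_mem hτ']
          exact min_le_min le_rfl (by exact_mod_cast hNM)
        · rw [indicator_of_notMem hτ]; exact bot_le
      · have h1 : Filter.Tendsto (fun N : ℕ => min (F τ) (N : ENNReal)) Filter.atTop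
            (nhds (F τ)) := by
          have := (tendsto_const_nhds (x := F τ) (f := Filter.atTop (α := ℕ))).min
            ENNReal.tendsto_nat_nhds_top
          simpa using this
        refine ((ENNReal.continuous_rpow_const (y := q)).tendsto _).comp (h1.congr' ?_)
        obtain ⟨N₀, hN₀⟩ := exists_nat_ge |τ|
        filter_upwards [Filter.eventually_ge_atTop N₀] with N hN
        have : (N₀:ℝ) ≤ N := by exact_mod_cast hN
        have hτ : τ ∈ Icc (-(N:ℝ)) N := abs_le.mp (hN₀.trans this)
        simp only [FN, indicator_of_mem hτ]
    exact le_of_tendsto' hlim hbd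
  set A := ∫⁻ t, g t ^ p with hA
  by_cases hA0 : A = 0
  · have hae : ∀ᵐ t, g t = 0 := by
      have := (lintegral_eq_zero_iff (by fun_prop)).mp hA0
      filter_upwards [this] with t ht
      simpa [hp0, hp0.le, not_lt.mpr hp0.le] using ht
    have : ∀ τ, ∫⁻ t, ENNReal.ofReal (|τ - t| ^ (-θ)) * g t = 0 := fun τ => by
      rw [← lintegral_zero]
      · refine lintegral_congr_ae ?_
        filter_upwards [hae] with t ht
        simp [ht]
    simp [this, ENNReal.zero_rpow_of_pos hq0]
  by_cases hAtop : A = ⊤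
  · rw [hAtop, ENNReal.top_rpow_of_pos (by positivity), ENNReal.mul_top (by simp; positivity)]
    exact le_top
  have hcA0 : A ^ (1 / p) ≠ 0 := by simp [ENNReal.rpow_eq_zero_iff, hA0, hAtop]
  have hcAtop : A ^ (1 / p) ≠ ⊤ := by simp [ENNReal.rpow_eq_top_iff, hA0, hAtop]
  have hN := norm (fun t => (A ^ (1 / p))⁻¹ * g t) (by fun_prop) (by
    have e : ∀ t, ((A ^ (1 / p))⁻¹ * g t) ^ p = A⁻¹ * g t ^ p := fun t => by
      rw [ENNReal.mul_rpow_of_nonneg _ _ hp0.le, ENNReal.inv_rpow, ← ENNReal.rpow_mul,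
        one_div_mul_cancel hp0.ne', ENNReal.rpow_one]
    simp_rw [e]
    rw [lintegral_const_mul' _ _ (ENNReal.inv_ne_top.mpr hA0), ← hA,
      ENNReal.inv_mul_cancel hA0 hAtop])
  have e : ∀ τ, (∫⁻ t, ENNReal.ofReal (|τ - t| ^ (-θ)) * g t) ^ q = A ^ (q / p) *
      (∫⁻ t, ENNReal.ofReal (|τ - t| ^ (-θ)) * ((A ^ (1 / p))⁻¹ * g t)) ^ q := fun τ => by
    have : A ^ (q / p) = (A ^ (1 / p)) ^ q := by
      rw [← ENNReal.rpow_mul]; congr 1; ring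
    rw [this, ← ENNReal.mul_rpow_of_nonneg _ _ hq0.le, ← lintegral_const_mul' _ _ hcAtop]
    congr 1
    refine lintegral_congr fun t => ?_
    calc _ = (A ^ (1 / p) * (A ^ (1 / p))⁻¹) * (ENNReal.ofReal (|τ - t| ^ (-θ)) * g t) := by
          rw [ENNReal.mul_inv_cancel hcA0 hcAtop, one_mul]
      _ = _ := by ring
  simp_rw [e]
  rw [lintegral_const_mul' _ _ (ENNReal.rpow_ne_top_of_nonneg (by positivity) hAtop), mul_comm]
  gcongr

lemma sw_conv (p q θ ε δ : ℝ) (hp : 1 ≤ p) (hpq : p ≤ q) (hθ : θ = 1 - 1 / p + 1 / q)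
    (hδ : 0 < δ) (hcase : ε < θ ∨ (ε = θ ∧ 1 < p ∧ p < q)) :
    ∃ C : ℝ, 0 < C ∧ ∀ g : ℝ → ENNReal, Measurable g →
      ∫⁻ τ, (∫⁻ t, ENNReal.ofReal (|τ - t| ^ (-ε) * Real.exp (-δ * |τ - t|)) * g t) ^ q ≤
        ENNReal.ofReal C * (∫⁻ t, g t ^ p) ^ (q / p) := by
  have hp0 : 0 < p := by linarith
  have hq0 : 0 < q := by linarith
  rcases hcase with hlt | ⟨rfl, hp1, hpq1⟩
  · have hp1 : 1 / p ≤ 1 := by rw [div_le_one hp0]; exact hp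
    have hθ0 : 0 < θ := by
      have : 0 < 1 / q := by positivity
      linarith
    set m := 1 / θ with hm
    have hm0 : 0 < m := by positivity
    let κ : ℝ → ENNReal := fun u => ENNReal.ofReal (|u| ^ (-ε) * Real.exp (-δ * |u|))
    have hκ : Measurable κ := by fun_prop
    have hfin : ∫⁻ u, κ u ^ m ≠ ⊤ := by
      have e : ∀ u, κ u ^ m = (fun s : ℝ => ENNReal.ofReal ((s ^ (-ε) * Real.exp (-δ * s)) ^ m)) |u| :=
        fun u => by
          simp only [κ]
          rw [ENNReal.ofReal_rpow_of_nonneg (by positivity) hm0.le]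
      simp_rw [e]
      rw [sw_even (fun s : ℝ => ENNReal.ofReal ((s ^ (-ε) * Real.exp (-δ * s)) ^ m))]
      refine ENNReal.mul_ne_top (by simp) ?_
      have hi : IntegrableOn (fun s : ℝ => s ^ (-ε * m) * Real.exp (-(δ * m) * s ^ (1:ℝ))) (Ioi 0) :=
        integrableOn_rpow_mul_exp_neg_mul_rpow (by
          have : ε * m < θ * m := by gcongr
          rw [hm, mul_one_div_cancel hθ0.ne', ← hm] at this
          linarith) one_pos (by positivity)
      have := hi.lintegral_lt_top
      rw [setLIntegral_congr_fun (g := fun s : ℝ =>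
        ENNReal.ofReal (s ^ (-ε * m) * Real.exp (-(δ * m) * s ^ (1:ℝ)))) measurableSet_Ioi]
      · exact this.ne
      · intro s hs
        have hs0 : 0 < s := hs
        simp only
        rw [Real.mul_rpow (by positivity) (by positivity), ← Real.rpow_mul hs0.le, ← Real.exp_mul,
          Real.rpow_one]
        congr 3; ring
    set A := ∫⁻ u, κ u ^ m with hA
    refine ⟨(A ^ (q / m)).toReal + 1, by positivity, fun g hg => ?_⟩
    refine (sw_young p q m hp hpq (by rw [hm, one_div_one_div, hθ]) κ g hκ hg).trans ?_
    gcongr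
    rw [← hA]
    have : A ^ (q / m) ≠ ⊤ := ENNReal.rpow_ne_top_of_nonneg (by positivity) hfin
    calc A ^ (q / m) = ENNReal.ofReal (A ^ (q / m)).toReal := (ENNReal.ofReal_toReal this).symm
      _ ≤ _ := ENNReal.ofReal_le_ofReal (by linarith)
  · obtain ⟨C, hC, H⟩ := sw_hls p q ε hp1 hpq1 hθ
    refine ⟨C, hC, fun g hg => le_trans (lintegral_mono fun τ => ?_) (H g hg)⟩
    refine ENNReal.rpow_le_rpow (lintegral_mono fun t => ?_) hq0.le
    gcongr
    refine mul_le_of_le_one_right (by positivity) ?_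
    rw [Real.exp_le_one_iff]
    have := abs_nonneg (τ - t)
    nlinarith

lemma sw_kernel_bound (a b γ ε δ : ℝ) (hab : a + b = γ) (hδ : 0 < δ) (hδa : δ ≤ a) (hδb : δ ≤ b)
    (hε : 0 < ε) (hε1 : ε ≤ 1) (τ t : ℝ) (hτt : τ ≠ t) :
    Real.exp (a * τ) * Real.exp (b * t) *
      (Real.exp (-γ * max τ t) * (1 - Real.exp (-|τ - t|)) ^ (-ε)) ≤
    (1 + 2 / δ) * (|τ - t| ^ (-ε) * Real.exp (-(δ / 2) * |τ - t|)) := by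
  have hw0 : 0 < |τ - t| := abs_pos.mpr (sub_ne_zero.mpr hτt)
  have h1 : Real.exp (a * τ) * Real.exp (b * t) * Real.exp (-γ * max τ t) ≤
      Real.exp (-δ * |τ - t|) := by
    rw [← Real.exp_add, ← Real.exp_add, Real.exp_le_exp, ← hab]
    rcases le_total τ t with h | h
    · rw [max_eq_right h, abs_of_nonpos (by linarith)]
      nlinarith
    · rw [max_eq_left h, abs_of_nonneg (by linarith)]
      nlinarith
  set w := |τ - t| with hw
  have h2 : w / (1 + w) ≤ 1 - Real.exp (-w) := by
    have h3 : Real.exp (-w) ≤ 1 / (1 + w) := by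
      rw [Real.exp_neg, ← one_div]
      apply one_div_le_one_div_of_le (by positivity)
      linarith [Real.add_one_le_exp w]
    have h4 : w / (1 + w) = 1 - 1 / (1 + w) := by field_simp; ring
    linarith
  have h3 : (1 - Real.exp (-w)) ^ (-ε) ≤ (1 + w) * w ^ (-ε) := by
    calc _ ≤ (w / (1 + w)) ^ (-ε) :=
          Real.rpow_le_rpow_of_nonpos (by positivity) h2 (by linarith)
      _ = (1 + w) ^ ε * w ^ (-ε) := by
          rw [Real.div_rpow hw0.le (by positivity), Real.rpow_neg (x := 1 + w) (by positivity),
            div_inv_eq_mul, mul_comm]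
      _ ≤ _ := by
          gcongr
          calc (1 + w) ^ ε ≤ (1 + w) ^ (1:ℝ) :=
                Real.rpow_le_rpow_of_exponent_le (by linarith) hε1
            _ = _ := Real.rpow_one _
  have h4 : 1 + w ≤ (1 + 2 / δ) * Real.exp (δ / 2 * w) := by
    have : 1 + w ≤ (1 + 2 / δ) * (δ / 2 * w + 1) := by
      have : (1 + 2 / δ) * (δ / 2 * w + 1) = 1 + w + δ / 2 * w + 2 / δ := by field_simp; ring
      rw [this]
      have : 0 < δ / 2 * w + 2 / δ := by positivity
      linarith
    refine this.trans ?_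
    gcongr
    exact Real.add_one_le_exp _
  calc _ = (Real.exp (a * τ) * Real.exp (b * t) * Real.exp (-γ * max τ t)) *
        (1 - Real.exp (-w)) ^ (-ε) := by ring
    _ ≤ Real.exp (-δ * w) * ((1 + w) * w ^ (-ε)) := by
        gcongr
        exact Real.rpow_nonneg ((by positivity : 0 ≤ w / (1 + w)).trans h2) _
    _ ≤ Real.exp (-δ * w) * (((1 + 2 / δ) * Real.exp (δ / 2 * w)) * w ^ (-ε)) := by gcongr
    _ = _ := by
        have : Real.exp (-(δ / 2) * w) = Real.exp (-δ * w) * Real.exp (δ / 2 * w) := by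
          rw [← Real.exp_add]; congr 1; ring
        rw [this]; ring

lemma sw_main (n : ℕ) (hn : 1 ≤ n) (p q γ α β ε : ℝ)
    (hp : 1 ≤ p) (hpq : p ≤ q)
    (hα : α < (n : ℝ) * (1 - 1 / p)) (hβ : β < (n : ℝ) / q)
    (hscale : 1 / q = 1 / p + (γ + α + β) / n - 1)
    (hε : 0 < ε) (hγε : γ ≤ ε + ((n:ℝ) - 1))
    (hcase : ε < 1 - 1 / p + 1 / q ∨ (ε = 1 - 1 / p + 1 / q ∧ 1 < p ∧ p < q)) :
    ∃ C : ℝ, 0 < C ∧ ∀ w : ℝ → ENNReal, Measurable w →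
      ∫⁻ x : SWE n, (ENNReal.ofReal (‖x‖ ^ (-β)) *
        ∫⁻ y : SWE n, w ‖y‖ * ENNReal.ofReal (‖x - y‖ ^ (-γ))) ^ q ≤
      ENNReal.ofReal C * (∫⁻ x : SWE n, (ENNReal.ofReal (‖x‖ ^ α) * w ‖x‖) ^ p) ^ (q / p) := by
  have : Nonempty (Fin n) := ⟨⟨0, hn⟩⟩
  have hn0 : (0:ℝ) < n := by exact_mod_cast hn
  have hp0 : 0 < p := by linarith
  have hq0 : 0 < q := by linarith
  have hpq' : 1 / q ≤ 1 / p := one_div_le_one_div_of_le hp0 hpq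
  set a := (n:ℝ) / q - β with ha
  set b := (n:ℝ) * (1 - 1 / p) - α with hb
  have hab : a + b = γ := by
    have : (n:ℝ) / q = n * (1 / q) := by ring
    rw [ha, hb, this, hscale]; field_simp; ring
  set δ := min a b with hδ
  have hδ0 : 0 < δ := lt_min (by linarith) (by linarith)
  have hε1 : ε ≤ 1 := by rcases hcase with h | ⟨h, _⟩ <;> linarith
  obtain ⟨C₁, hC₁, H₁⟩ := sw_sphere n hn γ ε hε hγε
  obtain ⟨C₂, hC₂, H₂⟩ := sw_conv p q _ ε (δ / 2) hp hpq rfl (by positivity) hcase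
  set σ := (volume : Measure (SWE n)).toSphere with hσ
  set S := (σ univ).toReal with hS
  have hσtop : σ univ ≠ ⊤ := measure_ne_top _ _
  have hσ0 : σ univ ≠ 0 := by
    rw [ne_eq, Measure.measure_univ_eq_zero]; exact Measure.toSphere_ne_zero _
  have hS0 : 0 < S := ENNReal.toReal_pos hσ0 hσtop
  have hσS : σ univ = ENNReal.ofReal S := (ENNReal.ofReal_toReal hσtop).symm
  set C₃ := C₁ * (1 + 2 / δ) with hC₃def
  have hC₃ : 0 < C₃ := by positivity
  refine ⟨S * (C₃ ^ q * (C₂ * (S⁻¹) ^ (q / p))), by positivity, fun w hw => ?_⟩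
  let g : ℝ → ENNReal := fun t => ENNReal.ofReal (Real.exp (t * (α + n / p))) * w (Real.exp t)
  have hg : Measurable g := by fun_prop
  let Ψ : ℝ → ENNReal := fun τ => ∫⁻ t,
    ENNReal.ofReal (|τ - t| ^ (-ε) * Real.exp (-(δ / 2) * |τ - t|)) * g t
  have hΨ : Measurable Ψ := Measurable.lintegral_prod_right'
    (f := fun z : ℝ × ℝ => ENNReal.ofReal (|z.1 - z.2| ^ (-ε) *
      Real.exp (-(δ / 2) * |z.1 - z.2|)) * g z.2) (by fun_prop)
  -- bound of the potential
  have hpot : ∀ (x : SWE n) (τ : ℝ), ‖x‖ = Real.exp τ →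
      ENNReal.ofReal (Real.exp (a * τ)) *
        (∫⁻ y : SWE n, w ‖y‖ * ENNReal.ofReal (‖x - y‖ ^ (-γ))) ≤ ENNReal.ofReal C₃ * Ψ τ := by
    intro x τ hx
    rw [sw_polar n hn _ (by fun_prop), ← lintegral_const_mul' _ _ ENNReal.ofReal_ne_top,
      ← lintegral_const_mul' _ _ ENNReal.ofReal_ne_top]
    refine lintegral_mono_ae ?_
    have hne : ∀ᵐ t : ℝ, t ≠ τ := by
      rw [ae_iff]; simp
    filter_upwards [hne] with t ht
    have e1 : ∀ ω : Metric.sphere (0 : SWE n) 1, ‖Real.exp t • (ω : SWE n)‖ = Real.exp t :=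
      fun ω => by simp [norm_smul]
    simp_rw [e1]
    rw [lintegral_const_mul _ (by fun_prop)]
    have h1 := H₁ x τ t hx (Ne.symm ht)
    have h2 := sw_kernel_bound a b γ ε δ hab hδ0 (min_le_left _ _) (min_le_right _ _) hε hε1 τ t
      (Ne.symm ht)
    have e2 : Real.exp (n * t) = Real.exp (b * t) * Real.exp (t * (α + n / p)) := by
      rw [← Real.exp_add]; congr 1; rw [hb]; ring
    rw [e2, ENNReal.ofReal_mul (Real.exp_pos _).le]
    calc _ ≤ ENNReal.ofReal (Real.exp (a * τ)) * (ENNReal.ofReal (Real.exp (b * t)) *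
          ENNReal.ofReal (Real.exp (t * (α + n / p))) * (w (Real.exp t) *
          ENNReal.ofReal (C₁ * (Real.exp (-γ * max τ t) *
            (1 - Real.exp (-|τ - t|)) ^ (-ε))))) := by gcongr
      _ = ENNReal.ofReal C₁ * (ENNReal.ofReal (Real.exp (a * τ) * Real.exp (b * t) *
            (Real.exp (-γ * max τ t) * (1 - Real.exp (-|τ - t|)) ^ (-ε)))) * g t := by
          rw [ENNReal.ofReal_mul hC₁.le,
            ENNReal.ofReal_mul (p := Real.exp (a * τ) * Real.exp (b * t)) (by positivity),
            ENNReal.ofReal_mul (p := Real.exp (a * τ)) (by positivity)]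
          simp only [g]
          ring
      _ ≤ ENNReal.ofReal C₁ * (ENNReal.ofReal ((1 + 2 / δ) * (|τ - t| ^ (-ε) *
            Real.exp (-(δ / 2) * |τ - t|)))) * g t := by gcongr
      _ = _ := by
          rw [hC₃def, ENNReal.ofReal_mul hC₁.le, ENNReal.ofReal_mul (p := 1 + 2 / δ) (by positivity)]
          ring
  let H : ℝ → ENNReal := fun r => ENNReal.ofReal (r ^ (-(n:ℝ))) *
    (ENNReal.ofReal C₃ * Ψ (Real.log r)) ^ q
  have hH : Measurable H := by fun_prop
  have hx0 : ∀ᵐ x : SWE n, x ≠ 0 := by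
    rw [ae_iff]; simp
  have hR : ∫⁻ x : SWE n, (ENNReal.ofReal (‖x‖ ^ α) * w ‖x‖) ^ p = σ univ * ∫⁻ t, g t ^ p := by
    rw [sw_polar_rad n hn (fun r => (ENNReal.ofReal (r ^ α) * w r) ^ p) (by fun_prop)]
    congr 1
    refine lintegral_congr fun t => ?_
    simp only [g]
    rw [ENNReal.mul_rpow_of_nonneg _ _ hp0.le, ENNReal.mul_rpow_of_nonneg _ _ hp0.le, ← mul_assoc,
      ENNReal.ofReal_rpow_of_pos (by positivity), ENNReal.ofReal_rpow_of_pos (by positivity),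
      ← ENNReal.ofReal_mul (by positivity), ← Real.exp_mul, ← Real.exp_mul, ← Real.exp_mul,
      ← Real.exp_add]
    congr 3
    field_simp; ring
  calc _ ≤ ∫⁻ x : SWE n, H ‖x‖ := by
        refine lintegral_mono_ae ?_
        filter_upwards [hx0] with x hx
        have hr : 0 < ‖x‖ := norm_pos_iff.mpr hx
        have h := hpot x (Real.log ‖x‖) (Real.exp_log hr).symm
        simp only [H]
        have e1 : ENNReal.ofReal (‖x‖ ^ (-β)) = ENNReal.ofReal (‖x‖ ^ (-(n:ℝ) / q)) *
            ENNReal.ofReal (Real.exp (a * Real.log ‖x‖)) := by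
          rw [← ENNReal.ofReal_mul (by positivity), mul_comm a, ← Real.rpow_def_of_pos hr,
            ← Real.rpow_add hr]
          congr 2; rw [ha]; ring
        rw [e1, mul_assoc]
        have e2 : ENNReal.ofReal (‖x‖ ^ (-(n:ℝ))) = ENNReal.ofReal (‖x‖ ^ (-(n:ℝ) / q)) ^ q := by
          rw [ENNReal.ofReal_rpow_of_pos (by positivity), ← Real.rpow_mul hr.le,
            div_mul_cancel₀ _ hq0.ne']
        rw [e2, ← ENNReal.mul_rpow_of_nonneg _ _ hq0.le]
        gcongr
    _ = σ univ * ∫⁻ t, (ENNReal.ofReal C₃ * Ψ t) ^ q := by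
        rw [sw_polar_rad n hn H hH]
        congr 1
        refine lintegral_congr fun t => ?_
        simp only [H]
        rw [← mul_assoc, ← ENNReal.ofReal_mul (by positivity), ← Real.exp_mul, ← Real.exp_add,
          Real.log_exp, show (n:ℝ) * t + t * -(n:ℝ) = 0 by ring, Real.exp_zero]
        simp
    _ = σ univ * (ENNReal.ofReal (C₃ ^ q) * ∫⁻ t, Ψ t ^ q) := by
        congr 1
        rw [← lintegral_const_mul' _ _ ENNReal.ofReal_ne_top]
        refine lintegral_congr fun t => ?_
        rw [ENNReal.mul_rpow_of_nonneg _ _ hq0.le, ENNReal.ofReal_rpow_of_pos hC₃]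
    _ ≤ σ univ * (ENNReal.ofReal (C₃ ^ q) * (ENNReal.ofReal C₂ * (∫⁻ t, g t ^ p) ^ (q / p))) := by
        gcongr
        exact H₂ g hg
    _ = _ := by
        rw [hR]
        have e1 : ∫⁻ t, g t ^ p = ENNReal.ofReal S⁻¹ * (σ univ * ∫⁻ t, g t ^ p) := by
          rw [← mul_assoc, hσS, ← ENNReal.ofReal_mul (by positivity), inv_mul_cancel₀ hS0.ne']
          simp
        have hqp : 0 ≤ q / p := by positivity
        conv_lhs => rw [e1, ENNReal.mul_rpow_of_nonneg _ _ hqp]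
        rw [ENNReal.ofReal_mul hS0.le, ENNReal.ofReal_mul (by positivity),
          ENNReal.ofReal_mul hC₂.le, ENNReal.ofReal_rpow_of_pos (by positivity), ← hσS]
        ring

theorem stmt12 (n : ℕ) (hn : 1 ≤ n) (p q γ α β : ℝ)
    (hp : 1 ≤ p) (hpq : p ≤ q) (hγ0 : 0 < γ) (hγn : γ < n)
    (hα : α < (n : ℝ) * (1 - 1 / p)) (hβ : β < (n : ℝ) / q)
    (hab : ((n : ℝ) - 1) * (1 / q - 1 / p) ≤ α + β)
    (hab1 : p = 1 → ((n : ℝ) - 1) * (1 / q - 1 / p) < α + β)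
    (hscale : 1 / q = 1 / p + (γ + α + β) / n - 1) :
    ∃ C > 0, ∀ v : EuclideanSpace ℝ (Fin n) → ℝ, Measurable v →
      (∃ v0 : ℝ → ℝ, ∀ x, v x = v0 ‖x‖) →
      Integrable (fun x : EuclideanSpace ℝ (Fin n) => (‖x‖ ^ α * |v x|) ^ p) →
      (∫ x : EuclideanSpace ℝ (Fin n),
          (‖x‖ ^ (-β) * |∫ y, v y / ‖x - y‖ ^ γ|) ^ q) ^ (1 / q)
        ≤ C * (∫ x : EuclideanSpace ℝ (Fin n), (‖x‖ ^ α * |v x|) ^ p) ^ (1 / p) := by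
  have hn0 : (0:ℝ) < n := by exact_mod_cast hn
  have hp0 : 0 < p := by linarith
  have hq0 : 0 < q := by linarith
  have hpq' : 1 / q ≤ 1 / p := one_div_le_one_div_of_le hp0 hpq
  have hp1 : 1 / p ≤ 1 := by rw [div_le_one hp0]; exact hp
  have hq1 : 0 < 1 / q := by positivity
  -- scaling relation, cleared of denominators
  have hsc : (n:ℝ) * (1 / q - 1 / p) = γ + (α + β) - n := by
    rw [hscale]; field_simp; ring
  have hε : ∃ ε : ℝ, 0 < ε ∧ γ ≤ ε + ((n:ℝ) - 1) ∧
      (ε < 1 - 1 / p + 1 / q ∨ (ε = 1 - 1 / p + 1 / q ∧ 1 < p ∧ p < q)) := by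
    rcases hab.lt_or_eq with hlt | heq
    · have h1 : γ - ((n:ℝ) - 1) < 1 - 1 / p + 1 / q := by linarith
      obtain ⟨ε, he1, he2⟩ := exists_between
        (max_lt h1 (show (0:ℝ) < 1 - 1 / p + 1 / q by linarith))
      exact ⟨ε, (le_max_right _ _).trans_lt he1,
        by linarith [(le_max_left _ _).trans_lt he1], Or.inl he2⟩
    · have h1 : γ - ((n:ℝ) - 1) = 1 - 1 / p + 1 / q := by linarith
      have hpne : p ≠ 1 := fun h => (hab1 h).ne heq
      refine ⟨1 - 1 / p + 1 / q, by linarith, by linarith, Or.inr ⟨rfl, lt_of_le_of_ne hp hpne.symm,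
        lt_of_le_of_ne hpq ?_⟩⟩
      rintro rfl
      linarith
  obtain ⟨ε, hε0, hγε, hcase⟩ := hε
  obtain ⟨C, hC, H⟩ := sw_main n hn p q γ α β ε hp hpq hα hβ hscale hε0 hγε hcase
  refine ⟨C ^ (1 / q), by positivity, ?_⟩
  rintro v hv ⟨v0, hv0⟩ hint
  let e : EuclideanSpace ℝ (Fin n) := EuclideanSpace.single ⟨0, hn⟩ 1
  have he : ‖e‖ = 1 := by simp [e]
  let w : ℝ → ENNReal := fun s => ‖v (s • e)‖ₑ
  have hw : Measurable w := by
    have : Measurable fun s : ℝ => v (s • e) := hv.comp (by fun_prop)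
    exact this.enorm
  have hwv : ∀ x, w ‖x‖ = ‖v x‖ₑ := fun x => by
    simp only [w]
    rw [hv0, hv0 x, norm_smul, he, mul_one, norm_norm]
  have key := H w hw
  set X := ∫ x : EuclideanSpace ℝ (Fin n), (‖x‖ ^ (-β) * |∫ y, v y / ‖x - y‖ ^ γ|) ^ q with hX
  set Y := ∫ x : EuclideanSpace ℝ (Fin n), (‖x‖ ^ α * |v x|) ^ p with hY
  have hX0 : 0 ≤ X := integral_nonneg fun x => by positivity
  have hY0 : 0 ≤ Y := integral_nonneg fun x => by positivity
  have hYe : ∫⁻ x : SWE n, (ENNReal.ofReal (‖x‖ ^ α) * w ‖x‖) ^ p = ENNReal.ofReal Y := by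
    rw [hY, ofReal_integral_eq_lintegral_ofReal hint
      (Filter.Eventually.of_forall fun x => by positivity)]
    refine lintegral_congr fun x => ?_
    rw [hwv, Real.enorm_eq_ofReal_abs, ← ENNReal.ofReal_mul (by positivity),
      ENNReal.ofReal_rpow_of_nonneg (by positivity) hp0.le]
  have hXe : ENNReal.ofReal X ≤ ∫⁻ x : SWE n, (ENNReal.ofReal (‖x‖ ^ (-β)) *
        ∫⁻ y : SWE n, w ‖y‖ * ENNReal.ofReal (‖x - y‖ ^ (-γ))) ^ q := by
    rw [← Real.enorm_of_nonneg hX0]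
    refine (enorm_integral_le_lintegral_enorm _).trans (lintegral_mono fun x => ?_)
    rw [Real.enorm_of_nonneg (by positivity), ← ENNReal.ofReal_rpow_of_nonneg (by positivity) hq0.le,
      ENNReal.ofReal_mul (by positivity), ← Real.enorm_eq_ofReal_abs]
    gcongr
    refine (enorm_integral_le_lintegral_enorm _).trans (lintegral_mono fun y => le_of_eq ?_)
    rw [hwv, Real.rpow_neg (norm_nonneg _), div_eq_mul_inv, enorm_mul,
      Real.enorm_of_nonneg (r := (‖x - y‖ ^ γ)⁻¹) (by positivity)]
  rw [hYe, ENNReal.ofReal_rpow_of_nonneg hY0 (by positivity), ← ENNReal.ofReal_mul hC.le] at key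
  clear hYe
  have hXe' := hXe.trans key
  clear hXe key
  clear_value X Y
  clear hX hY
  have hXY : X ≤ C * Y ^ (q / p) :=
    (ENNReal.ofReal_le_ofReal_iff (mul_nonneg hC.le (Real.rpow_nonneg hY0 _))).mp hXe'
  calc X ^ (1 / q) ≤ (C * Y ^ (q / p)) ^ (1 / q) :=
        Real.rpow_le_rpow hX0 hXY hq1.le
    _ = _ := by
        rw [Real.mul_rpow hC.le (by positivity), ← Real.rpow_mul hY0]
        congr 2
        field_simp
end

section
/- Let $n \ge 1$, $p, q \ge 1$, $r > 0$, $0 \le a \le 1$, and $\alpha, \beta, \sigma \in \mathbb{R}$, with $\gamma = a\sigma + (1-a)\beta$. Assume $\frac{1}{p} + \frac{\alpha}{n} > 0$, $\frac{1}{q} + \frac{\beta}{n} > 0$, $\frac{1}{r} + \frac{\gamma}{n} > 0$, the scaling relation $\frac{1}{r} + \frac{\gamma}{n} = a\left(\frac{1}{p} + \frac{\alpha-1}{n}\right) + (1-a)\left(\frac{1}{q} + \frac{\beta}{n}\right)$, $\frac{1-a}{q} \le \frac{1}{r} \le \frac{a}{p} + \frac{1-a}{q}$, and, if $a > 0$: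 $(n-1)\left[\frac{1}{a}\left(\frac{1}{r} - \frac{1}{q}\right) + \frac{1}{q} - \frac{1}{p}\right] \le \alpha - \sigma \le 0$ (strict left inequality if $p = 1$) and $-\frac{\sigma}{n} < \frac{1}{a}\left(\frac{1}{r} - \frac{1}{q}\right) + \frac{1}{q}$. Then there exists $C > 0$ such that for all radially symmetric $u \in C_0^\infty(\mathbb{R}^n)$, $\left\| |x|^{\gamma} u \right\|_{L^r} \le C \left\| |x|^{\alpha} \nabla u \right\|_{L^p}^{a} \left\| |x|^{\beta} u \right\|_{L^q}^{1-a}$. -/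
open MeasureTheory Set

lemma holder_aux {X : Type*} [MeasurableSpace X] {m : Measure X} {f g h : X → ℝ} {θ K : ℝ}
    (hθ0 : 0 ≤ θ) (hθ1 : θ ≤ 1) (hK : 0 ≤ K)
    (hf : Integrable f m) (hg : Integrable g m) (hf0 : 0 ≤ᵐ[m] f) (hg0 : 0 ≤ᵐ[m] g)
    (hh0 : 0 ≤ᵐ[m] h) (hh : ∀ᵐ x ∂m, h x ≤ K * (f x ^ (1 - θ) * g x ^ θ)) :
    ∫ x, h x ∂m ≤ K * ((∫ x, f x ∂m) ^ (1 - θ) * (∫ x, g x ∂m) ^ θ) := by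
  have hint : Integrable (fun x => f x ^ (1 - θ) * g x ^ θ) m := by
    refine Integrable.mono' ((hf.const_mul (1 - θ)).add (hg.const_mul θ)) ?_ ?_
    · exact ((hf.aestronglyMeasurable.aemeasurable.pow_const _).mul
        (hg.aestronglyMeasurable.aemeasurable.pow_const _)).aestronglyMeasurable
    · filter_upwards [hf0, hg0] with x h1 h2
      simp only [Pi.zero_apply] at h1 h2
      rw [Real.norm_of_nonneg (by positivity)]
      exact Real.geom_mean_le_arith_mean2_weighted (by linarith) hθ0 h1 h2 (by ring)
  have h1 : ∫ x, h x ∂m ≤ ∫ x, K * (f x ^ (1 - θ) * g x ^ θ) ∂m :=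
    integral_mono_of_nonneg hh0 (hint.const_mul K) hh
  refine h1.trans ?_
  rw [integral_const_mul]
  refine mul_le_mul_of_nonneg_left ?_ hK
  have hF := integral_nonneg_of_ae hf0
  have hG := integral_nonneg_of_ae hg0
  have key : ENNReal.ofReal (∫ x, f x ^ (1 - θ) * g x ^ θ ∂m)
      ≤ ENNReal.ofReal ((∫ x, f x ∂m) ^ (1 - θ) * (∫ x, g x ∂m) ^ θ) := by
    rw [ofReal_integral_eq_lintegral_ofReal hint, ENNReal.ofReal_mul (by positivity),
      ← ENNReal.ofReal_rpow_of_nonneg hF (by linarith), ← ENNReal.ofReal_rpow_of_nonneg hG hθ0,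
      ofReal_integral_eq_lintegral_ofReal hf hf0, ofReal_integral_eq_lintegral_ofReal hg hg0]
    · refine le_trans (le_of_eq ?_) (ENNReal.lintegral_mul_norm_pow_le
        (hf.aestronglyMeasurable.aemeasurable.ennreal_ofReal)
        (hg.aestronglyMeasurable.aemeasurable.ennreal_ofReal) (by linarith) hθ0 (by ring))
      refine lintegral_congr_ae ?_
      filter_upwards [hf0, hg0] with x h1 h2
      simp only [Pi.zero_apply] at h1 h2
      rw [ENNReal.ofReal_mul (by positivity), ← ENNReal.ofReal_rpow_of_nonneg h1 (by linarith),
        ← ENNReal.ofReal_rpow_of_nonneg h2 hθ0]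
    · filter_upwards [hf0, hg0] with x h1 h2
      simp only [Pi.zero_apply] at h1 h2 ⊢
      positivity
  exact (ENNReal.ofReal_le_ofReal_iff (by positivity)).1 key

lemma young_aux {p k x y : ℝ} (hp : 1 ≤ p) (hk : 0 < k) (hx : 0 ≤ x) (hy : 0 ≤ y) :
    x ^ (p - 1) * y ≤ k * x ^ p + k⁻¹ ^ (p - 1) * y ^ p := by
  have e : ∀ z : ℝ, 0 ≤ z → z ^ p = z ^ (p - 1) * z := by
    intro z hz
    conv_lhs => rw [show p = (p - 1) + 1 by ring]
    rw [Real.rpow_add_of_nonneg hz (by linarith) (by norm_num), Real.rpow_one]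
  rcases le_total y (k * x) with h | h
  · have : x ^ (p - 1) * y ≤ k * x ^ p := by
      rw [e x hx]
      calc x ^ (p - 1) * y ≤ x ^ (p - 1) * (k * x) := by gcongr
        _ = _ := by ring
    have : 0 ≤ k⁻¹ ^ (p - 1) * y ^ p := by positivity
    linarith
  · have h2 : x ≤ k⁻¹ * y := by
      rw [inv_mul_eq_div, le_div_iff₀ hk]; linarith
    have : x ^ (p - 1) * y ≤ k⁻¹ ^ (p - 1) * y ^ p := by
      rw [e y hy, ← mul_assoc, ← Real.mul_rpow (by positivity) hy]
      gcongr
    have : 0 ≤ k * x ^ p := by positivity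
    linarith

lemma hardy_aux (p μ : ℝ) (hp : 1 ≤ p) (hμ : 0 < μ) :
    ∃ C > 0, ∀ f : ℝ → ℝ, ContDiff ℝ 1 f → ∀ R : ℝ, 0 < R → f R = 0 →
      (∀ t, 0 < t → t ≤ R → (t ^ μ * |f t|) ^ p
        ≤ C * ∫ t in (0:ℝ)..R, t ^ (μ * p + p - 1) * |deriv f t| ^ p) ∧
      ∫ t in (0:ℝ)..R, t ^ (μ * p - 1) * |f t| ^ p
        ≤ C * ∫ t in (0:ℝ)..R, t ^ (μ * p + p - 1) * |deriv f t| ^ p := by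
  set D : ℝ := 2 * ((μ / 2)⁻¹ ^ (p - 1)) with hD
  have hDpos : 0 < D := by positivity
  refine ⟨p * D + D / μ, by positivity, ?_⟩
  intro f hf R hR hfR
  set J := ∫ t in (0:ℝ)..R, t ^ (μ * p + p - 1) * |deriv f t| ^ p with hJ
  have hdc : Continuous (deriv f) := hf.continuous_deriv le_rfl
  have hmp : 0 < μ * p := by positivity
  set F : ℝ → ℝ := fun t => ∫ s in t..R, |deriv f s| with hF
  have hFd : ∀ t, HasDerivAt F (-|deriv f t|) t := fun t =>
    intervalIntegral.integral_hasDerivAt_left (hdc.abs.intervalIntegrable _ _)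
      hdc.abs.stronglyMeasurable.stronglyMeasurableAtFilter hdc.abs.continuousAt
  have hFc : Continuous F := continuous_iff_continuousAt.2 fun t => (hFd t).continuousAt
  have hF0 : ∀ t, t ≤ R → 0 ≤ F t := fun t ht =>
    intervalIntegral.integral_nonneg ht fun _ _ => abs_nonneg _
  have hFR : F R = 0 := by simp [hF]
  have hfF : ∀ t, t ≤ R → |f t| ≤ F t := by
    intro t ht
    have h1 : ∫ s in t..R, deriv f s = f R - f t :=
      intervalIntegral.integral_deriv_eq_sub (fun x _ => (hf.differentiable one_ne_zero) x)
        (hdc.intervalIntegrable _ _)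
    have h2 := intervalIntegral.abs_integral_le_integral_abs (f := deriv f) (μ := volume) ht
    rw [h1, hfR, zero_sub, abs_neg] at h2
    exact h2
  -- pieces
  set A : ℝ → ℝ := fun t => t ^ (μ * p - 1) * F t ^ p with hA
  set B : ℝ → ℝ := fun t => t ^ (μ * p) * (F t ^ (p - 1) * |deriv f t|) with hB
  have cpow : ∀ e : ℝ, 0 ≤ e → Continuous fun t : ℝ => t ^ e := fun e he =>
    Real.continuous_rpow_const he
  have hBc : Continuous B :=
    (cpow _ hmp.le).mul ((hFc.rpow_const fun _ => Or.inr (by linarith)).mul hdc.abs)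
  have hFpc : Continuous fun t => F t ^ p := hFc.rpow_const fun _ => Or.inr (by linarith)
  have hAi : IntervalIntegrable A volume 0 R :=
    (intervalIntegral.intervalIntegrable_rpow' (by linarith)).mul_continuousOn hFpc.continuousOn
  have hJi : IntervalIntegrable (fun t => t ^ (μ * p + p - 1) * |deriv f t| ^ p) volume 0 R :=
    ((cpow _ (by linarith)).mul (hdc.abs.rpow_const fun _ => Or.inr (by linarith))).intervalIntegrable _ _
  set Φ : ℝ → ℝ := fun t => t ^ (μ * p) * F t ^ p with hΦ
  have hΦc : Continuous Φ := (cpow _ hmp.le).mul hFpc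
  have hΦd : ∀ t, 0 < t → HasDerivAt Φ (μ * p * A t - p * B t) t := by
    intro t ht
    have h1 := (Real.hasDerivAt_rpow_const (x := t) (p := μ * p) (Or.inl ht.ne')).mul
      ((hFd t).rpow_const (p := p) (Or.inr hp))
    refine h1.congr_deriv ?_
    simp only [hA, hB]; ring
  have ftc : ∀ t, 0 ≤ t → t ≤ R → ∫ s in t..R, (μ * p * A s - p * B s) = - Φ t := by
    intro t ht0 ht
    have := intervalIntegral.integral_eq_sub_of_hasDerivAt_of_le ht hΦc.continuousOn
      (fun x hx => hΦd x (ht0.trans_lt hx.1))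
      (((hAi.const_mul (μ * p)).sub ((hBc.intervalIntegrable 0 R).const_mul p)).mono_set
        (by rw [uIcc_of_le ht, uIcc_of_le hR.le]; exact Icc_subset_Icc_left ht0))
    rw [this]
    simp [hΦ, hFR, Real.zero_rpow (by linarith : p ≠ 0)]
  have hAi' : ∀ t, 0 ≤ t → t ≤ R → IntervalIntegrable A volume t R := fun t ht0 ht =>
    hAi.mono_set (by rw [uIcc_of_le ht, uIcc_of_le hR.le]; exact Icc_subset_Icc_left ht0)
  have hA0 : ∀ t, 0 ≤ t → t ≤ R → 0 ≤ A t := fun t h0 h1 => by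
    have := hF0 t h1
    simp only [hA]; positivity
  have hB0 : ∀ t, 0 ≤ t → t ≤ R → 0 ≤ B t := fun t h0 h1 => by
    have := hF0 t h1
    simp only [hB]; positivity
  set K := ∫ s in (0:ℝ)..R, B s with hK
  set I := ∫ s in (0:ℝ)..R, A s with hI
  have e1 : μ * I = K := by
    have := ftc 0 le_rfl hR.le
    rw [intervalIntegral.integral_sub (hAi.const_mul _) ((hBc.intervalIntegrable 0 R).const_mul p),
      intervalIntegral.integral_const_mul, intervalIntegral.integral_const_mul] at this
    simp only [hΦ, Real.zero_rpow hmp.ne', zero_mul, neg_zero] at this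
    have h3 : p * (μ * I - K) = 0 := by rw [← this]; ring
    rcases mul_eq_zero.1 h3 with h | h <;> linarith
  have e2 : ∀ t, 0 ≤ t → t ≤ R → Φ t ≤ p * K := by
    intro t h0 h1
    have := ftc t h0 h1
    rw [intervalIntegral.integral_sub ((hAi' t h0 h1).const_mul _)
      ((hBc.intervalIntegrable t R).const_mul p),
      intervalIntegral.integral_const_mul, intervalIntegral.integral_const_mul] at this
    have h2 : 0 ≤ ∫ s in t..R, A s :=
      intervalIntegral.integral_nonneg h1 fun s hs => hA0 s (h0.trans hs.1) hs.2
    have h3 : ∫ s in t..R, B s ≤ K := by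
      have h4 : 0 ≤ ∫ s in (0:ℝ)..t, B s :=
        intervalIntegral.integral_nonneg h0 fun s hs => hB0 s hs.1 (hs.2.trans h1)
      rw [hK, ← intervalIntegral.integral_add_adjacent_intervals
        (hBc.intervalIntegrable 0 t) (hBc.intervalIntegrable t R)]
      linarith
    have h5 : 0 ≤ μ * p * ∫ s in t..R, A s := by positivity
    have h6 : p * ∫ s in t..R, B s ≤ p * K := by gcongr
    linarith
  have e3 : K ≤ μ / 2 * I + D / 2 * J := by
    rw [hK, hI, hJ, ← intervalIntegral.integral_const_mul, ← intervalIntegral.integral_const_mul,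
      ← intervalIntegral.integral_add (hAi.const_mul _) (hJi.const_mul _)]
    refine intervalIntegral.integral_mono_on_of_le_Ioo hR.le (hBc.intervalIntegrable _ _)
      ((hAi.const_mul _).add (hJi.const_mul _)) ?_
    intro t ht
    have hFt := hF0 t ht.2.le
    have ht0 := ht.1
    have := young_aux (x := F t) (y := t * |deriv f t|) hp (half_pos hμ) hFt (by positivity)
    have h2 := mul_le_mul_of_nonneg_left this (Real.rpow_nonneg ht0.le (μ * p - 1))
    have s1 : t ^ (μ * p) = t ^ (μ * p - 1) * t := by
      rw [← Real.rpow_add_one ht0.ne']; ring_nf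
    have s2 : t ^ (μ * p + p - 1) = t ^ (μ * p - 1) * t ^ p := by
      rw [← Real.rpow_add ht0]; ring_nf
    simp only [hA, hB, s1, s2, hD]
    rw [Real.mul_rpow ht0.le (abs_nonneg _)] at h2
    refine le_trans (le_of_eq ?_) (h2.trans (le_of_eq ?_)) <;> ring
  have hJ0 : 0 ≤ J := intervalIntegral.integral_nonneg hR.le fun s hs => by
    have := hs.1
    positivity
  have e4 : K ≤ D * J := by nlinarith
  have hKI : I ≤ D / μ * J := by
    rw [div_mul_eq_mul_div, le_div_iff₀ hμ]; linarith
  constructor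
  · intro t h0 h1
    have h2 := e2 t h0.le h1
    have h3 : (t ^ μ * |f t|) ^ p ≤ Φ t := by
      simp only [hΦ]
      rw [Real.mul_rpow (by positivity) (abs_nonneg _), ← Real.rpow_mul h0.le]
      have := hfF t h1
      gcongr
    have h4 : p * K ≤ p * (D * J) := by gcongr
    have h5 : 0 ≤ D / μ * J := by positivity
    nlinarith
  · have h1 : ∫ t in (0:ℝ)..R, t ^ (μ * p - 1) * |f t| ^ p ≤ I := by
      refine intervalIntegral.integral_mono_on_of_le_Ioo hR.le ?_ hAi ?_
      · exact (intervalIntegral.intervalIntegrable_rpow' (by linarith)).mul_continuousOn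
          (hf.continuous.abs.rpow_const fun _ => Or.inr (by linarith)).continuousOn
      · intro t ht
        have := hfF t ht.2.le
        have := ht.1
        simp only [hA]
        gcongr
    have h5 : 0 ≤ p * D * J := by positivity
    nlinarith

lemma interp_aux (p q r a μ ν : ℝ) (hp : 1 ≤ p) (hq : 1 ≤ q) (hr : 0 < r) (ha0 : 0 ≤ a)
    (ha1 : a ≤ 1) (hμ : 0 < μ) (hν : 0 < ν)
    (hqr1 : (1 - a) / q ≤ 1 / r) (hqr2 : 1 / r ≤ a / p + (1 - a) / q) :
    ∃ C > 0, ∀ f : ℝ → ℝ, ContDiff ℝ 1 f → ∀ R : ℝ, 0 < R → f R = 0 →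
      ∫ t in Ioc 0 R, t ^ (r * (a * μ + (1 - a) * ν) - 1) * |f t| ^ r
        ≤ (C * ∫ t in Ioc 0 R, t ^ (μ * p + p - 1) * |deriv f t| ^ p) ^ (a * r / p) *
          (∫ t in Ioc 0 R, t ^ (ν * q - 1) * |f t| ^ q) ^ ((1 - a) * r / q) := by
  obtain ⟨C, hC, H⟩ := hardy_aux p μ hp hμ
  refine ⟨C, hC, ?_⟩
  intro f hf R hR hfR
  obtain ⟨H1, H2⟩ := H f hf R hR hfR
  rw [intervalIntegral.integral_of_le hR.le, intervalIntegral.integral_of_le hR.le] at H2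
  simp only [intervalIntegral.integral_of_le hR.le] at H1
  have hp0 : 0 < p := by linarith
  have hq0 : 0 < q := by linarith
  set J := ∫ t in Ioc 0 R, t ^ (μ * p + p - 1) * |deriv f t| ^ p with hJ
  set θ := (1 - a) * r / q with hθ
  have hθ0 : 0 ≤ θ := by
    have : 0 ≤ 1 - a := by linarith
    positivity
  have hθ1 : θ ≤ 1 := by
    have := mul_le_mul_of_nonneg_right hqr1 hr.le
    rw [one_div, inv_mul_cancel₀ hr.ne'] at this
    rw [hθ]; linarith [this, (by ring : (1 - a) / q * r = (1 - a) * r / q)]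
  have hθ2 : 1 - θ ≤ a * r / p := by
    have := mul_le_mul_of_nonneg_right hqr2 hr.le
    rw [one_div, inv_mul_cancel₀ hr.ne'] at this
    rw [hθ]; linarith [this, (by ring : (a / p + (1 - a) / q) * r = a * r / p + (1 - a) * r / q)]
  have hθq : q * θ = (1 - a) * r := by rw [hθ]; field_simp
  have hJ0 : 0 ≤ J := by
    refine setIntegral_nonneg measurableSet_Ioc fun t ht => ?_
    have := ht.1
    positivity
  set I := ∫ t in Ioc 0 R, t ^ (μ * p - 1) * |f t| ^ p with hI
  have hI0 : 0 ≤ I := by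
    refine setIntegral_nonneg measurableSet_Ioc fun t ht => ?_
    have := ht.1
    positivity
  set L := ∫ t in Ioc 0 R, t ^ (ν * q - 1) * |f t| ^ q with hL
  have hL0 : 0 ≤ L := by
    refine setIntegral_nonneg measurableSet_Ioc fun t ht => ?_
    have := ht.1
    positivity
  have ii : ∀ s e : ℝ, 0 < s → 0 < e →
      IntegrableOn (fun t : ℝ => t ^ (e - 1) * |f t| ^ s) (Ioc 0 R) := by
    intro s e hs he
    rw [← intervalIntegrable_iff_integrableOn_Ioc_of_le hR.le]
    exact (intervalIntegral.intervalIntegrable_rpow' (by linarith)).mul_continuousOn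
          (hf.continuous.abs.rpow_const fun _ => Or.inr hs.le).continuousOn
  have pos : ∀ s e : ℝ, 0 ≤ᵐ[volume.restrict (Ioc 0 R)] (fun t : ℝ => t ^ (e - 1) * |f t| ^ s) := by
    intro s e
    refine ae_restrict_of_forall_mem measurableSet_Ioc fun t ht => ?_
    have := ht.1
    simp only [Pi.zero_apply]
    positivity
  have key := holder_aux (m := volume.restrict (Ioc 0 R)) (θ := θ)
    (K := (C * J) ^ (a * r / p - (1 - θ)))
    (f := fun t : ℝ => t ^ (μ * p - 1) * |f t| ^ p) (g := fun t : ℝ => t ^ (ν * q - 1) * |f t| ^ q)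
    (h := fun t : ℝ => t ^ (r * (a * μ + (1 - a) * ν) - 1) * |f t| ^ r)
    hθ0 hθ1 (by positivity) (ii p _ hp0 (by positivity)) (ii q _ hq0 (by positivity))
    (pos _ _) (pos _ _) (pos _ _) ?_
  · refine key.trans ?_
    have h1 : I ^ (1 - θ) ≤ (C * J) ^ (1 - θ) := by
      have : 0 ≤ 1 - θ := by linarith
      gcongr
    have h2 : (C * J) ^ (a * r / p) = (C * J) ^ (a * r / p - (1 - θ)) * (C * J) ^ (1 - θ) := by
      rw [← Real.rpow_add_of_nonneg (by positivity) (by linarith) (by linarith)]; ring_nf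
    rw [h2, mul_assoc]
    gcongr
  · refine ae_restrict_of_forall_mem measurableSet_Ioc fun t ht => ?_
    have ht0 := ht.1
    have hX := H1 t ht.1 ht.2
    have hX' : (t ^ μ * |f t|) ^ (a * r - p * (1 - θ)) ≤ (C * J) ^ (a * r / p - (1 - θ)) := by
      have e : a * r - p * (1 - θ) = p * (a * r / p - (1 - θ)) := by field_simp
      rw [e, Real.rpow_mul (by positivity)]
      exact Real.rpow_le_rpow (by positivity) hX (by linarith)
    have hnn : 0 ≤ a * r - p * (1 - θ) := by
      have := mul_le_mul_of_nonneg_left hθ2 hp0.le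
      rw [mul_div_cancel₀ _ hp0.ne'] at this
      linarith
    refine le_trans (le_of_eq ?_) (mul_le_mul_of_nonneg_right hX' (by positivity))
    rw [Real.mul_rpow (by positivity) (by positivity), Real.mul_rpow (by positivity) (by positivity),
      Real.mul_rpow (by positivity) (by positivity), ← Real.rpow_mul ht0.le, ← Real.rpow_mul ht0.le,
      ← Real.rpow_mul ht0.le, ← Real.rpow_mul (abs_nonneg _), ← Real.rpow_mul (abs_nonneg _)]
    have hr' : r = (a * r - p * (1 - θ)) + p * (1 - θ) + q * θ := by rw [hθq]; ring
    have f1 : |f t| ^ r = |f t| ^ (a * r - p * (1 - θ)) * |f t| ^ (p * (1 - θ)) * |f t| ^ (q * θ) := by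
      have b1 : 0 ≤ p * (1 - θ) := mul_nonneg hp0.le (by linarith)
      have b2 : 0 ≤ q * θ := by positivity
      rw [← Real.rpow_add_of_nonneg (abs_nonneg _) hnn b1,
        ← Real.rpow_add_of_nonneg (abs_nonneg _) (by linarith) b2, ← hr']
    have f2 : t ^ (r * (a * μ + (1 - a) * ν) - 1) = t ^ (μ * (a * r - p * (1 - θ))) *
        t ^ ((μ * p - 1) * (1 - θ)) * t ^ ((ν * q - 1) * θ) := by
      rw [← Real.rpow_add ht0, ← Real.rpow_add ht0]
      congr 1
      linear_combination -ν * hθq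
    rw [f1, f2]
    ring

lemma radial_aux (n : ℕ) (hn : 1 ≤ n) (u : EuclideanSpace ℝ (Fin n) → ℝ)
    (hu : ContDiff ℝ (⊤ : ℕ∞) u) (hc : HasCompactSupport u)
    (hrad : ∃ u0 : ℝ → ℝ, ∀ x, u x = u0 ‖x‖) :
    ∃ f : ℝ → ℝ, ContDiff ℝ 1 f ∧ (∀ x, u x = f ‖x‖) ∧
      (∀ x, x ≠ 0 → ‖fderiv ℝ u x‖ = |deriv f ‖x‖|) ∧
      ∃ R > 0, ∀ t, R ≤ t → f t = 0 := by
  obtain ⟨u0, h0⟩ := hrad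
  haveI : Nonempty (Fin n) := ⟨⟨0, hn⟩⟩
  obtain ⟨e, he⟩ := exists_norm_eq (EuclideanSpace ℝ (Fin n)) zero_le_one
  have hf : ContDiff ℝ 1 (fun t : ℝ => u (t • e)) :=
    (hu.of_le (by exact_mod_cast le_top)).comp (contDiff_id.smul contDiff_const)
  have hux : ∀ x, u x = u (‖x‖ • e) := by
    intro x
    rw [h0 x, h0 (‖x‖ • e), norm_smul, he, norm_norm, mul_one]
  refine ⟨fun t => u (t • e), hf, hux, ?_, ?_⟩
  · intro x hx
    have hd : DifferentiableAt ℝ (fun y : EuclideanSpace ℝ (Fin n) => ‖y‖) x :=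
      (contDiffAt_norm ℝ hx (n := 1)).differentiableAt one_ne_zero
    have h1 : HasFDerivAt ((fun t : ℝ => u (t • e)) ∘ fun y : EuclideanSpace ℝ (Fin n) => ‖y‖) _ x :=
      ((hf.differentiable one_ne_zero ‖x‖).hasDerivAt).comp_hasFDerivAt x hd.hasFDerivAt
    have h2 : u = ((fun t : ℝ => u (t • e)) ∘ fun y : EuclideanSpace ℝ (Fin n) => ‖y‖) := by
      funext x; exact hux x
    have h3 : fderiv ℝ u x = deriv (fun t : ℝ => u (t • e)) ‖x‖ •
        fderiv ℝ (fun y : EuclideanSpace ℝ (Fin n) => ‖y‖) x := by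
      rw [← h1.fderiv, ← h2]
    rw [h3, norm_smul, norm_fderiv_norm hd, mul_one, Real.norm_eq_abs]
  · obtain ⟨R, hR⟩ := hc.isCompact.isBounded.subset_closedBall 0
    refine ⟨max R 0 + 1, by positivity, fun t ht => ?_⟩
    by_contra hne
    have := hR (subset_tsupport _ hne)
    rw [mem_closedBall_zero_iff, norm_smul, he, mul_one, Real.norm_eq_abs] at this
    have := le_abs_self t
    have := le_max_left R 0
    linarith

theorem stmt13 (n : ℕ) (hn : 1 ≤ n) (p q r a α β σ γ : ℝ)
    (hp : 1 ≤ p) (hq : 1 ≤ q) (hr : 0 < r) (ha0 : 0 ≤ a) (ha1 : a ≤ 1)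
    (hγ : γ = a * σ + (1 - a) * β)
    (hc1 : 0 < 1 / p + α / n) (hc2 : 0 < 1 / q + β / n) (hc3 : 0 < 1 / r + γ / n)
    (hscale : 1 / r + γ / n
      = a * (1 / p + (α - 1) / n) + (1 - a) * (1 / q + β / n))
    (hqr1 : (1 - a) / q ≤ 1 / r) (hqr2 : 1 / r ≤ a / p + (1 - a) / q)
    (hlow : 0 < a →
      ((n : ℝ) - 1) * ((1 / a) * (1 / r - 1 / q) + 1 / q - 1 / p) ≤ α - σ)
    (hlow' : 0 < a → p = 1 →
      ((n : ℝ) - 1) * ((1 / a) * (1 / r - 1 / q) + 1 / q - 1 / p) < α - σ)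
    (hup : 0 < a → α - σ ≤ 0)
    (hσ : 0 < a → -σ / n < (1 / a) * (1 / r - 1 / q) + 1 / q) :
    ∃ C > 0, ∀ u : EuclideanSpace ℝ (Fin n) → ℝ,
      ContDiff ℝ (⊤ : ℕ∞) u → HasCompactSupport u →
      (∃ u0 : ℝ → ℝ, ∀ x, u x = u0 ‖x‖) →
      (∫ x, (‖x‖ ^ γ * |u x|) ^ r) ^ (1 / r)
        ≤ C * ((∫ x, (‖x‖ ^ α * ‖fderiv ℝ u x‖) ^ p) ^ (1 / p)) ^ a *
            ((∫ x, (‖x‖ ^ β * |u x|) ^ q) ^ (1 / q)) ^ (1 - a) := by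
  have hp0 : 0 < p := by linarith
  have hq0 : 0 < q := by linarith
  rcases ha0.eq_or_lt with rfl | ha
  · have hrq : r = q := by
      have : 1 / r = 1 / q := le_antisymm (by simpa using hqr2) (by simpa using hqr1)
      rw [one_div, one_div] at this
      exact inv_injective this
    have hγβ : γ = β := by rw [hγ]; ring
    subst hrq
    subst hγβ
    exact ⟨1, one_pos, fun u _ _ _ => by simp⟩
  have hnR : (0:ℝ) < n := by exact_mod_cast hn
  haveI : Nonempty (Fin n) := ⟨⟨0, hn⟩⟩
  set μ : ℝ := n / p + α - 1 with hμd
  set ν : ℝ := n / q + β with hνd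
  have hν : 0 < ν := by
    have : ν = n * (1 / q + β / n) := by rw [hνd]; field_simp
    rw [this]; positivity
  have hsc : n / r + γ = a * μ + (1 - a) * ν := by
    have h1 := congrArg (fun z => (n:ℝ) * z) hscale
    have h2 : (n:ℝ) * (1 / r + γ / n) = n / r + γ := by field_simp
    have h3 : (n:ℝ) * (a * (1 / p + (α - 1) / n) + (1 - a) * (1 / q + β / n))
        = a * μ + (1 - a) * ν := by
      rw [hμd, hνd]; field_simp; ring
    rw [← h2, h1, h3]
  have hμ : 0 < μ := by
    have h1 := hσ ha
    have h2 : 0 < a * (σ + n * ((1 / a) * (1 / r - 1 / q) + 1 / q)) := by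
      have := mul_lt_mul_of_pos_left h1 hnR
      rw [mul_div_cancel₀ _ hnR.ne'] at this
      have : 0 < σ + n * ((1 / a) * (1 / r - 1 / q) + 1 / q) := by linarith
      positivity
    have h3 : a * (σ + n * ((1 / a) * (1 / r - 1 / q) + 1 / q)) = a * μ := by
      have : a * (σ + n * ((1 / a) * (1 / r - 1 / q) + 1 / q))
        = a * σ + n / r - (1 - a) * (n / q) := by field_simp; ring
      rw [this]
      rw [hγ, hνd] at hsc
      linarith
    rw [h3] at h2
    exact pos_of_mul_pos_right h2 ha.le
  obtain ⟨C, hC, H⟩ := interp_aux p q r a μ ν hp hq hr ha0 ha1 hμ hν hqr1 hqr2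
  set c : ℝ := n * volume.real (Metric.ball (0 : EuclideanSpace ℝ (Fin n)) 1) with hcd
  have hc : 0 < c := by
    have : 0 < volume.real (Metric.ball (0 : EuclideanSpace ℝ (Fin n)) 1) :=
      ENNReal.toReal_pos (Metric.measure_ball_pos _ _ one_pos).ne' measure_ball_lt_top.ne
    positivity
  have rad : ∀ g : ℝ → ℝ, ∫ x : EuclideanSpace ℝ (Fin n), g ‖x‖
      = c * ∫ t in Ioi (0:ℝ), t ^ (n - 1) * g t := by
    intro g
    rw [integral_fun_norm_addHaar volume g]
    simp [hcd, mul_assoc]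
  refine ⟨c ^ (1 / r) * (C / c) ^ (a / p) * (1 / c) ^ ((1 - a) / q), by positivity, ?_⟩
  intro u hu hcs hrad
  obtain ⟨f, hf, hfu, hfd, R, hR, hfR⟩ := radial_aux n hn u hu hcs hrad
  have hdR : ∀ t, R < t → deriv f t = 0 := by
    intro t ht
    have : f =ᶠ[nhds t] fun _ => 0 := by
      filter_upwards [Ioi_mem_nhds ht] with s hs using hfR s (le_of_lt hs)
    rw [this.deriv_eq]; simp
  have red : ∀ (g : ℝ → ℝ) (s e e' : ℝ), 0 < s → e' = s * e + n - 1 → (∀ t, R < t → g t = 0) →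
      ∫ x : EuclideanSpace ℝ (Fin n), (‖x‖ ^ e * |g ‖x‖|) ^ s
        = c * ∫ t in Ioc 0 R, t ^ e' * |g t| ^ s := by
    intro g s e e' hs he' hg
    rw [rad fun t => (t ^ e * |g t|) ^ s]
    congr 1
    have h1 : ∫ t in Ioi (0:ℝ), t ^ (n - 1) * (t ^ e * |g t|) ^ s
        = ∫ t in Ioi (0:ℝ), t ^ e' * |g t| ^ s := by
      refine setIntegral_congr_fun measurableSet_Ioi fun t ht => ?_
      have ht : 0 < t := ht
      rw [Real.mul_rpow (by positivity) (abs_nonneg _), ← Real.rpow_mul ht.le, ← mul_assoc,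
        ← Real.rpow_natCast, ← Real.rpow_add ht, he', Nat.cast_sub hn]
      congr 2
      push_cast; ring
    rw [h1]
    refine setIntegral_eq_of_subset_of_forall_sdiff_eq_zero measurableSet_Ioi
      (fun t ht => ht.1) fun t ht => ?_
    have : R < t := by
      by_contra hcon
      exact ht.2 ⟨ht.1, not_lt.1 hcon⟩
    rw [hg t this, abs_zero, Real.zero_rpow hs.ne', mul_zero]
  have E1 : ∫ x, (‖x‖ ^ γ * |u x|) ^ r
      = c * ∫ t in Ioc 0 R, t ^ (r * (a * μ + (1 - a) * ν) - 1) * |f t| ^ r := by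
    rw [← red f r γ _ hr (by rw [← hsc]; field_simp; ring) fun t ht => hfR t ht.le]
    simp only [← hfu]
  have E2 : ∫ x, (‖x‖ ^ α * ‖fderiv ℝ u x‖) ^ p
      = c * ∫ t in Ioc 0 R, t ^ (μ * p + p - 1) * |deriv f t| ^ p := by
    rw [← red (deriv f) p α _ hp0 (by rw [hμd]; field_simp; ring) hdR]
    refine integral_congr_ae ?_
    have : ∀ᵐ x : EuclideanSpace ℝ (Fin n), x ≠ 0 := by
      simp [ae_iff]
    filter_upwards [this] with x hx
    rw [hfd x hx]
  have E3 : ∫ x, (‖x‖ ^ β * |u x|) ^ q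
      = c * ∫ t in Ioc 0 R, t ^ (ν * q - 1) * |f t| ^ q := by
    rw [← red f q β _ hq0 (by rw [hνd]; field_simp; ring) fun t ht => hfR t ht.le]
    simp only [← hfu]
  rw [E1, E2, E3]
  have key := H f hf R hR (hfR R le_rfl)
  have nn : ∀ (g : ℝ → ℝ) (s e : ℝ), 0 ≤ ∫ t in Ioc 0 R, t ^ e * |g t| ^ s := by
    intro g s e
    refine setIntegral_nonneg measurableSet_Ioc fun t ht => ?_
    have := ht.1
    positivity
  have nI := nn f r (r * (a * μ + (1 - a) * ν) - 1)
  have nJ := nn (deriv f) p (μ * p + p - 1)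
  have nL := nn f q (ν * q - 1)
  set I := ∫ t in Ioc 0 R, t ^ (r * (a * μ + (1 - a) * ν) - 1) * |f t| ^ r
  set J := ∫ t in Ioc 0 R, t ^ (μ * p + p - 1) * |deriv f t| ^ p
  set L := ∫ t in Ioc 0 R, t ^ (ν * q - 1) * |f t| ^ q
  have h1 : I ^ (1 / r) ≤ (C * J) ^ (a / p) * L ^ ((1 - a) / q) := by
    have h2 := Real.rpow_le_rpow nI key (by positivity : 0 ≤ 1 / r)
    rw [Real.mul_rpow (by positivity) (by positivity), ← Real.rpow_mul (by positivity),
      ← Real.rpow_mul nL] at h2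
    convert h2 using 3 <;> field_simp
  rw [Real.mul_rpow hc.le nI, ← Real.rpow_mul (by positivity), ← Real.rpow_mul (by positivity),
    one_div_mul_eq_div, one_div_mul_eq_div]
  have h3 : (C * J) ^ (a / p) = (C / c) ^ (a / p) * (c * J) ^ (a / p) := by
    rw [← Real.mul_rpow (by positivity) (by positivity)]; congr 1; field_simp
  have h4 : L ^ ((1 - a) / q) = (1 / c) ^ ((1 - a) / q) * (c * L) ^ ((1 - a) / q) := by
    rw [← Real.mul_rpow (by positivity) (by positivity)]; congr 1; field_simp
  rw [h3, h4] at h1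
  calc c ^ (1 / r) * I ^ (1 / r) ≤ c ^ (1 / r) * _ := mul_le_mul_of_nonneg_left h1 (by positivity)
    _ = _ := by ring
end
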